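/- arXiv:1310.6391 — 8 statements merged into one kernel-verified Lean document; each statement's English description precedes it below -/
import Mathlib

section
/- Let S be a measurable space, let ν be a probability measure on S, let β, γ ∈ ℝ\{0} with β < γ, and let g : S → ℝ be bounded and measurable. Then (1/β) log ∫_S e^{βg} dν = inf over all probability measures θ on S of [ (1/γ) log ∫_S e^{γg} dθ + (1/(γ−β)) R_{γ/(γ−β)}(ν‖θ) ]. -/
open MeasureTheory Real ProbabilityTheory
open scoped Classical

/-- Rényi divergence of order `α > 0`, `α ≠ 1`, of `ν` from `θ`, defined using densities with
respect to the dominating measure `ν + θ`. -/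
noncomputable def renyiDivAux {S : Type*} [MeasurableSpace S] (α : ℝ)
    (ν θ : Measure S) : EReal :=
  if 1 < α ∧ ¬ ν ≪ θ then ⊤
  else ((α * (α - 1))⁻¹ : ℝ) *
    ENNReal.log (∫⁻ x in {x | 0 < ν.rnDeriv (ν + θ) x ∧ 0 < θ.rnDeriv (ν + θ) x},
      (ν.rnDeriv (ν + θ) x / θ.rnDeriv (ν + θ) x) ^ α ∂θ)

/-- Rényi divergence of order `α ∈ ℝ \ {0, 1}`, extended to negative orders by
`R_α(ν‖θ) = R_{1-α}(θ‖ν)`. -/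
noncomputable def renyiDiv {S : Type*} [MeasurableSpace S] (α : ℝ)
    (ν θ : Measure S) : EReal :=
  if α < 0 then renyiDivAux (1 - α) θ ν else renyiDivAux α ν θ

open scoped ENNReal

section CommonSupport

variable {S : Type*} [MeasurableSpace S]

/-- The set on which both densities with respect to `ν + θ` are positive. -/
noncomputable def commonSupport (ν θ : Measure S) : Set S :=
  {x | 0 < ν.rnDeriv (ν + θ) x ∧ 0 < θ.rnDeriv (ν + θ) x}

/-- The ratio of the densities of `ν` and `θ` with respect to `ν + θ`. -/
noncomputable def densityRatio (ν θ : Measure S) (x : S) : ℝ≥0∞ :=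
  ν.rnDeriv (ν + θ) x / θ.rnDeriv (ν + θ) x

/-- The integral whose logarithm defines the Rényi divergence of order `α`. -/
noncomputable def renyiIntegral (α : ℝ) (ν θ : Measure S) : ℝ≥0∞ :=
  ∫⁻ x in commonSupport ν θ, densityRatio ν θ x ^ α ∂θ

lemma renyiDivAux_eq_log_renyiIntegral {α : ℝ} {ν θ : Measure S} (h : 1 < α → ν ≪ θ) :
    renyiDivAux α ν θ = ((α * (α - 1))⁻¹ : ℝ) * ENNReal.log (renyiIntegral α ν θ) :=
  if_neg fun h' ↦ h'.2 (h h'.1)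

lemma measurableSet_commonSupport (ν θ : Measure S) : MeasurableSet (commonSupport ν θ) :=
  (measurableSet_lt measurable_const (Measure.measurable_rnDeriv _ _)).inter
    (measurableSet_lt measurable_const (Measure.measurable_rnDeriv _ _))

lemma measurable_densityRatio (ν θ : Measure S) : Measurable (densityRatio ν θ) :=
  (Measure.measurable_rnDeriv _ _).div (Measure.measurable_rnDeriv _ _)

lemma absolutelyContinuous_add_left (ν θ : Measure S) : ν ≪ ν + θ :=
  Measure.AbsolutelyContinuous.rfl.add_right θ

lemma absolutelyContinuous_add_right (ν θ : Measure S) : θ ≪ ν + θ :=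
  add_comm θ ν ▸ Measure.AbsolutelyContinuous.rfl.add_right ν

lemma ae_mem_commonSupport {ν θ : Measure S} [IsFiniteMeasure ν] [IsFiniteMeasure θ]
    (h : ν ≪ θ) : ∀ᵐ x ∂ν, x ∈ commonSupport ν θ := by
  filter_upwards [Measure.rnDeriv_pos (absolutelyContinuous_add_left ν θ),
    h.ae_le (Measure.rnDeriv_pos (absolutelyContinuous_add_right ν θ))] with x h₁ h₂
  exact ⟨h₁, h₂⟩

lemma commonSupport_comm (ν θ : Measure S) : commonSupport ν θ = commonSupport θ ν := by
  ext x
  simp only [commonSupport, add_comm θ ν, Set.mem_ofPred_eq, and_comm]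

/-- On the common support, `densityRatio ν θ` is a density of `ν` with respect to `θ`. -/
lemma setLIntegral_densityRatio_mul (ν θ : Measure S) [IsFiniteMeasure ν] [IsFiniteMeasure θ]
    {u : S → ℝ≥0∞} (hu : Measurable u) :
    ∫⁻ x in commonSupport ν θ, densityRatio ν θ x * u x ∂θ
      = ∫⁻ x in commonSupport ν θ, u x ∂ν := by
  have hA := measurableSet_commonSupport ν θ
  rw [← setLIntegral_rnDeriv_mul (f := fun x ↦ densityRatio ν θ x * u x)
      (absolutelyContinuous_add_right ν θ) ((measurable_densityRatio ν θ).mul hu).aemeasurable hA,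
    ← setLIntegral_rnDeriv_mul (absolutelyContinuous_add_left ν θ) hu.aemeasurable hA]
  refine setLIntegral_congr_fun_ae hA ?_
  filter_upwards [Measure.rnDeriv_lt_top θ (ν + θ)] with x hx hxA
  rw [densityRatio, ← mul_assoc, ENNReal.mul_div_cancel hxA.2.ne' hx.ne]

/-- Hölder's inequality bounding an integral against `ν` for orders above one. -/
lemma lintegral_rpow_le_mul_renyiIntegral {α : ℝ} (hα : 1 < α) {ν θ : Measure S}
    [IsFiniteMeasure ν] [IsFiniteMeasure θ] (h : ν ≪ θ) {u : S → ℝ≥0∞} (hu : Measurable u) :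
    ∫⁻ x, u x ^ (1 - α⁻¹) ∂ν ≤ (∫⁻ x, u x ∂θ) ^ (1 - α⁻¹) * renyiIntegral α ν θ ^ α⁻¹ := by
  have hα₀ : 0 < α := one_pos.trans hα
  have hα₁ : 0 ≤ 1 - α⁻¹ := sub_nonneg.2 (inv_le_one_of_one_le₀ hα.le)
  have hr := measurable_densityRatio ν θ
  calc ∫⁻ x, u x ^ (1 - α⁻¹) ∂ν
      = ∫⁻ x in commonSupport ν θ, u x ^ (1 - α⁻¹) ∂ν := by
        rw [Measure.restrict_eq_self_of_ae_mem (ae_mem_commonSupport h)]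
    _ = ∫⁻ x in commonSupport ν θ, u x ^ (1 - α⁻¹) * (densityRatio ν θ x ^ α) ^ α⁻¹ ∂θ := by
        rw [← setLIntegral_densityRatio_mul ν θ (hu.pow_const _)]
        simp_rw [ENNReal.rpow_rpow_inv hα₀.ne', mul_comm]
    _ ≤ (∫⁻ x in commonSupport ν θ, u x ∂θ) ^ (1 - α⁻¹) * renyiIntegral α ν θ ^ α⁻¹ :=
        ENNReal.lintegral_mul_norm_pow_le hu.aemeasurable (hr.pow_const _).aemeasurable
          hα₁ (inv_nonneg.2 hα₀.le) (sub_add_cancel _ _)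
    _ ≤ _ := by
        gcongr
        exact Measure.restrict_le_self

/-- Hölder's inequality bounding the Rényi integral of order below one. -/
lemma renyiIntegral_le_rpow_mul_rpow {α : ℝ} (hα₀ : 0 < α) (hα₁ : α < 1) (ν θ : Measure S)
    [IsFiniteMeasure ν] [IsFiniteMeasure θ] {u v : S → ℝ≥0∞} (hu : Measurable u)
    (hv : Measurable v) (huv : ∀ x, u x ^ α * v x ^ (1 - α) = 1) :
    renyiIntegral α ν θ ≤ (∫⁻ x, u x ∂ν) ^ α * (∫⁻ x, v x ∂θ) ^ (1 - α) := by
  have hr := measurable_densityRatio ν θ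
  calc renyiIntegral α ν θ
      = ∫⁻ x in commonSupport ν θ, (densityRatio ν θ x * u x) ^ α * v x ^ (1 - α) ∂θ := by
        refine lintegral_congr fun x ↦ ?_
        rw [ENNReal.mul_rpow_of_nonneg _ _ hα₀.le, mul_assoc, huv, mul_one]
    _ ≤ (∫⁻ x in commonSupport ν θ, densityRatio ν θ x * u x ∂θ) ^ α
          * (∫⁻ x in commonSupport ν θ, v x ∂θ) ^ (1 - α) :=
        ENNReal.lintegral_mul_norm_pow_le (hr.mul hu).aemeasurable hv.aemeasurable
          hα₀.le (sub_nonneg.2 hα₁.le) (add_sub_cancel _ _)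
    _ ≤ _ := by
        rw [setLIntegral_densityRatio_mul ν θ hu]
        have := sub_nonneg.2 hα₁.le
        gcongr <;> exact Measure.restrict_le_self

end CommonSupport

section ExponentialIntegrals

variable {S : Type*} [MeasurableSpace S]

lemma integrable_exp_mul_of_bounded (μ : Measure S) [IsFiniteMeasure μ] {g : S → ℝ}
    (hg : Measurable g) (hgbd : ∃ C : ℝ, ∀ x, |g x| ≤ C) (c : ℝ) :
    Integrable (fun x ↦ exp (c * g x)) μ := by
  obtain ⟨C, hC⟩ := hgbd
  refine Integrable.of_bound (by fun_prop) (exp (|c| * C)) (ae_of_all _ fun x ↦ ?_)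
  rw [norm_of_nonneg (exp_pos _).le]
  refine exp_le_exp.2 ((le_abs_self _).trans ?_)
  rw [abs_mul]
  exact mul_le_mul_of_nonneg_left (hC x) (abs_nonneg c)

lemma lintegral_ofReal_exp {μ : Measure S} {f : S → ℝ}
    (hf : Integrable (fun x ↦ exp (f x)) μ) :
    ∫⁻ x, ENNReal.ofReal (exp (f x)) ∂μ = ENNReal.ofReal (∫ x, exp (f x) ∂μ) :=
  (ofReal_integral_eq_lintegral_ofReal hf (ae_of_all _ fun _ ↦ (exp_pos _).le)).symm

/-- The Rényi integral of a probability measure from one of its exponential tilts. -/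
lemma log_renyiIntegral_tilted (α : ℝ) (ν : Measure S) [IsProbabilityMeasure ν] {f : S → ℝ}
    (hfm : Measurable f) (hf : Integrable (fun x ↦ exp (f x)) ν)
    (hf' : Integrable (fun x ↦ exp ((1 - α) * f x)) ν) :
    ENNReal.log (renyiIntegral α ν (ν.tilted f))
      = (((α - 1) * log (∫ x, exp (f x) ∂ν) + log (∫ x, exp ((1 - α) * f x) ∂ν) : ℝ) : EReal) := by
  have hprob := isProbabilityMeasure_tilted hf
  have hZ : 0 < ∫ x, exp (f x) ∂ν := integral_exp_pos hf
  have hB : 0 < ∫ x, exp ((1 - α) * f x) ∂ν := integral_exp_pos hf'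
  have hac := tilted_absolutelyContinuous ν f
  have hmem : ∀ᵐ x ∂ν.tilted f, x ∈ commonSupport ν (ν.tilted f) := by
    rw [commonSupport_comm]
    exact ae_mem_commonSupport hac
  have hratio : ∀ᵐ x ∂ν.tilted f,
      densityRatio ν (ν.tilted f) x = ENNReal.ofReal ((∫ y, exp (f y) ∂ν) * exp (-f x)) := by
    have hsum := absolutelyContinuous_add_right ν (ν.tilted f)
    filter_upwards [hmem, hsum.ae_le (rnDeriv_tilted_left ν hfm.aemeasurable),
      hsum.ae_le (Measure.rnDeriv_lt_top ν (ν + ν.tilted f))] with x hx h₁ h₂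
    rw [densityRatio, h₁, ENNReal.div_eq_inv_mul, ENNReal.mul_inv (Or.inr h₂.ne) (Or.inr hx.1.ne'),
      mul_assoc, ENNReal.inv_mul_cancel hx.1.ne' h₂.ne, mul_one,
      ← ENNReal.ofReal_inv_of_pos (by positivity), inv_div, exp_neg, div_eq_mul_inv]
  have hI : renyiIntegral α ν (ν.tilted f) = ENNReal.ofReal
      ((∫ x, exp (f x) ∂ν) ^ (α - 1) * ∫ x, exp ((1 - α) * f x) ∂ν) := by
    rw [renyiIntegral, Measure.restrict_eq_self_of_ae_mem hmem]
    calc ∫⁻ x, densityRatio ν (ν.tilted f) x ^ α ∂ν.tilted f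
        = ∫⁻ x, ENNReal.ofReal ((∫ y, exp (f y) ∂ν) * exp (-f x)) ^ α ∂ν.tilted f := by
          refine lintegral_congr_ae ?_
          filter_upwards [hratio] with x hx
          rw [hx]
      _ = ∫⁻ x, ENNReal.ofReal ((∫ y, exp (f y) ∂ν) ^ (α - 1))
            * ENNReal.ofReal (exp ((1 - α) * f x)) ∂ν := by
          rw [lintegral_tilted]
          refine lintegral_congr fun x ↦ ?_
          rw [ENNReal.ofReal_rpow_of_pos (by positivity), ← ENNReal.ofReal_mul (by positivity),
            ← ENNReal.ofReal_mul (by positivity), mul_rpow hZ.le (exp_pos _).le,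
            ← exp_mul, rpow_sub_one hZ.ne']
          congr 1
          have : (1 - α) * f x = f x + -f x * α := by ring
          rw [this, exp_add]
          ring
      _ = _ := by
          rw [lintegral_const_mul _ (by fun_prop), lintegral_ofReal_exp hf',
            ← ENNReal.ofReal_mul (by positivity)]
  rw [hI, ENNReal.log_ofReal_of_pos (by positivity), log_mul (by positivity) hB.ne',
    log_rpow hZ]

lemma inv_mul_inv_renyi_order {β γ : ℝ} (hd : γ - β ≠ 0) :
    (γ - β)⁻¹ * (γ / (γ - β) * (γ / (γ - β) - 1))⁻¹ = (γ - β) / (γ * β) := by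
  have hα : γ / (γ - β) - 1 = β / (γ - β) := by
    field_simp
    ring
  rw [hα]
  field_simp

/-- Lower bound for orders above one. -/
lemma log_integral_exp_le_of_pos {ν θ : Measure S} [IsProbabilityMeasure ν]
    [IsProbabilityMeasure θ] {β γ : ℝ} (hβ : 0 < β) (hβγ : β < γ) {g : S → ℝ}
    (hg : Measurable g) (hgbd : ∃ C : ℝ, ∀ x, |g x| ≤ C) :
    ((β⁻¹ * log (∫ x, exp (β * g x) ∂ν) : ℝ) : EReal) ≤
      ((γ⁻¹ * log (∫ x, exp (γ * g x) ∂θ) : ℝ) : EReal)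
        + (((γ - β)⁻¹ : ℝ) : EReal) * renyiDivAux (γ / (γ - β)) ν θ := by
  have hγ : 0 < γ := hβ.trans hβγ
  have hd : 0 < γ - β := sub_pos.2 hβγ
  have hα : 1 < γ / (γ - β) := (one_lt_div hd).2 (by linarith)
  by_cases hac : ν ≪ θ
  swap
  · rw [renyiDivAux, if_pos ⟨hα, hac⟩, EReal.coe_mul_top_of_pos (inv_pos.2 hd),
      EReal.coe_add_top]
    exact le_top
  have hexp : 1 - (γ / (γ - β))⁻¹ = β / γ := by field_simp; ring
  have hB := integrable_exp_mul_of_bounded ν hg hgbd β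
  have hG := integrable_exp_mul_of_bounded θ hg hgbd γ
  have hBpos := integral_exp_pos hB
  have hGpos := integral_exp_pos hG
  have hle := lintegral_rpow_le_mul_renyiIntegral hα hac
    (u := fun x ↦ ENNReal.ofReal (exp (γ * g x))) (by fun_prop)
  have hpow (x : S) : ENNReal.ofReal (exp (γ * g x)) ^ (β / γ)
      = ENNReal.ofReal (exp (β * g x)) := by
    rw [ENNReal.ofReal_rpow_of_pos (exp_pos _), ← exp_mul]
    congr 2
    field_simp
  rw [hexp, lintegral_congr hpow, lintegral_ofReal_exp hB, lintegral_ofReal_exp hG, inv_div] at hle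
  have hlog := ENNReal.log_le_log hle
  rw [ENNReal.log_mul_add, ENNReal.log_rpow, ENNReal.log_rpow, ENNReal.log_ofReal_of_pos hBpos,
    ENNReal.log_ofReal_of_pos hGpos] at hlog
  rw [renyiDivAux_eq_log_renyiIntegral fun _ ↦ hac, ← mul_assoc, ← EReal.coe_mul,
    inv_mul_inv_renyi_order hd.ne']
  have hc : 0 < (γ - β) / (γ * β) := by positivity
  generalize ENNReal.log (renyiIntegral (γ / (γ - β)) ν θ) = L at hlog ⊢
  induction L with
  | bot =>
    rw [EReal.coe_mul_bot_of_pos (by positivity), EReal.add_bot] at hlog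
    exact absurd hlog (not_le.2 (EReal.bot_lt_coe _))
  | top =>
    rw [EReal.coe_mul_top_of_pos hc, EReal.coe_add_top]
    exact le_top
  | coe l =>
    norm_cast at hlog ⊢
    have := mul_le_mul_of_nonneg_left hlog (inv_pos.2 hβ).le
    refine this.trans_eq ?_
    field_simp

/-- Lower bound for orders between zero and one. -/
lemma log_integral_exp_le_of_neg_of_pos {ν θ : Measure S} [IsProbabilityMeasure ν]
    [IsProbabilityMeasure θ] {β γ : ℝ} (hβ : β < 0) (hγ : 0 < γ) {g : S → ℝ}
    (hg : Measurable g) (hgbd : ∃ C : ℝ, ∀ x, |g x| ≤ C) :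
    ((β⁻¹ * log (∫ x, exp (β * g x) ∂ν) : ℝ) : EReal) ≤
      ((γ⁻¹ * log (∫ x, exp (γ * g x) ∂θ) : ℝ) : EReal)
        + (((γ - β)⁻¹ : ℝ) : EReal) * renyiDivAux (γ / (γ - β)) ν θ := by
  have hd : 0 < γ - β := by linarith
  have hα₀ : 0 < γ / (γ - β) := by positivity
  have hα₁ : γ / (γ - β) < 1 := (div_lt_one hd).2 (by linarith)
  have hB := integrable_exp_mul_of_bounded ν hg hgbd β
  have hG := integrable_exp_mul_of_bounded θ hg hgbd γ
  have hBpos := integral_exp_pos hB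
  have hGpos := integral_exp_pos hG
  have hle := renyiIntegral_le_rpow_mul_rpow hα₀ hα₁ ν θ
    (u := fun x ↦ ENNReal.ofReal (exp (β * g x))) (v := fun x ↦ ENNReal.ofReal (exp (γ * g x)))
    (by fun_prop) (by fun_prop) fun x ↦ by
      rw [ENNReal.ofReal_rpow_of_pos (exp_pos _), ENNReal.ofReal_rpow_of_pos (exp_pos _),
        ← ENNReal.ofReal_mul (by positivity), ← exp_mul, ← exp_mul, ← exp_add,
        ENNReal.ofReal_eq_one, exp_eq_one_iff]
      field_simp
      ring
  rw [lintegral_ofReal_exp hB, lintegral_ofReal_exp hG] at hle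
  have hlog := ENNReal.log_le_log hle
  rw [ENNReal.log_mul_add, ENNReal.log_rpow, ENNReal.log_rpow, ENNReal.log_ofReal_of_pos hBpos,
    ENNReal.log_ofReal_of_pos hGpos] at hlog
  rw [renyiDivAux_eq_log_renyiIntegral fun h ↦ absurd h hα₁.not_gt, ← mul_assoc,
    ← EReal.coe_mul,
    inv_mul_inv_renyi_order hd.ne']
  have hc : (γ - β) / (γ * β) < 0 := div_neg_of_pos_of_neg hd (mul_neg_of_pos_of_neg hγ hβ)
  generalize ENNReal.log (renyiIntegral (γ / (γ - β)) ν θ) = L at hlog ⊢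
  induction L with
  | bot =>
    rw [EReal.coe_mul_bot_of_neg hc, EReal.coe_add_top]
    exact le_top
  | top =>
    norm_cast at hlog
  | coe l =>
    norm_cast at hlog ⊢
    have := mul_le_mul_of_nonpos_left hlog hc.le
    have hβ₀ := hβ.ne
    have heq : (γ - β) / (γ * β) * (γ / (γ - β) * log (∫ x, exp (β * g x) ∂ν)
        + (1 - γ / (γ - β)) * log (∫ x, exp (γ * g x) ∂θ))
        = β⁻¹ * log (∫ x, exp (β * g x) ∂ν) - γ⁻¹ * log (∫ x, exp (γ * g x) ∂θ) := by
      field_simp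
      ring
    linarith

/-- Lower bound for negative orders. -/
lemma log_integral_exp_le_of_neg {ν θ : Measure S} [IsProbabilityMeasure ν]
    [IsProbabilityMeasure θ] {β γ : ℝ} (hγ : γ < 0) (hβγ : β < γ) {g : S → ℝ}
    (hg : Measurable g) (hgbd : ∃ C : ℝ, ∀ x, |g x| ≤ C) :
    ((β⁻¹ * log (∫ x, exp (β * g x) ∂ν) : ℝ) : EReal) ≤
      ((γ⁻¹ * log (∫ x, exp (γ * g x) ∂θ) : ℝ) : EReal)
        + (((γ - β)⁻¹ : ℝ) : EReal) * renyiDivAux (1 - γ / (γ - β)) θ ν := by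
  have hd : 0 < γ - β := sub_pos.2 hβγ
  have h := log_integral_exp_le_of_pos (ν := θ) (θ := ν) (neg_pos.2 hγ) (neg_lt_neg hβγ) hg.neg
    (by simpa using hgbd)
  have hα : -β / (γ - β) = 1 - γ / (γ - β) := by
    field_simp
    ring
  simp only [Pi.neg_apply, neg_mul_neg, neg_sub_neg, hα] at h
  generalize (((γ - β)⁻¹ : ℝ) : EReal) * renyiDivAux (1 - γ / (γ - β)) θ ν = R at h ⊢
  induction R with
  | bot =>
    rw [EReal.add_bot] at h
    exact absurd h (not_le.2 (EReal.bot_lt_coe _))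
  | top => exact (EReal.coe_add_top _).symm ▸ le_top
  | coe r =>
    norm_cast at h ⊢
    rw [inv_neg, inv_neg] at h
    linarith

/-- The Rényi divergence of a probability measure from one of its exponential tilts. -/
lemma renyiDiv_tilted (α : ℝ) (ν : Measure S) [IsProbabilityMeasure ν] {f : S → ℝ}
    (hfm : Measurable f) (hf : Integrable (fun x ↦ exp (f x)) ν)
    (hf' : Integrable (fun x ↦ exp ((1 - α) * f x)) ν) :
    renyiDiv α ν (ν.tilted f) = (((α * (α - 1))⁻¹ *
      ((α - 1) * log (∫ x, exp (f x) ∂ν) + log (∫ x, exp ((1 - α) * f x) ∂ν)) : ℝ) : EReal) := by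
  rw [renyiDiv]
  split_ifs
  · have hprob := isProbabilityMeasure_tilted hf
    have hZ : 0 < ∫ x, exp (f x) ∂ν := integral_exp_pos hf
    have hB : 0 < ∫ x, exp ((1 - α) * f x) ∂ν := integral_exp_pos hf'
    have hsum : (fun x ↦ exp ((f + fun x ↦ α * -f x) x)) = fun x ↦ exp ((1 - α) * f x) := by
      funext x
      simp only [Pi.add_apply]
      ring_nf
    have hint : Integrable (fun x ↦ exp (α * -f x)) (ν.tilted f) := by
      rw [integrable_tilted_iff hf]
      refine hf'.congr (ae_of_all _ fun x ↦ ?_)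
      simp only [smul_eq_mul, ← exp_add]
      ring_nf
    have hint' : Integrable (fun x ↦ exp ((-f) x)) (ν.tilted f) := by
      rw [integrable_tilted_iff hf]
      simp [← exp_add]
    have hlog := log_renyiIntegral_tilted (1 - α) (ν.tilted f) hfm.neg hint'
      (by simpa using hint)
    have hexp : ∫ x, exp ((-f) x) ∂ν.tilted f = (∫ x, exp (f x) ∂ν)⁻¹ := by
      rw [integral_exp_tilted]
      simp
    have hexp' : ∫ x, exp (α * -f x) ∂ν.tilted f
        = (∫ x, exp ((1 - α) * f x) ∂ν) / ∫ x, exp (f x) ∂ν := by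
      rw [integral_exp_tilted, hsum]
    rw [tilted_neg_same hf, hexp] at hlog
    simp only [sub_sub_cancel, Pi.neg_apply, hexp'] at hlog
    rw [renyiDivAux_eq_log_renyiIntegral fun _ ↦ tilted_absolutelyContinuous ν f, hlog,
      ← EReal.coe_mul, log_inv, log_div hB.ne' hZ.ne']
    congr 1
    ring
  · rw [renyiDivAux_eq_log_renyiIntegral fun _ ↦ absolutelyContinuous_tilted hf,
      log_renyiIntegral_tilted α ν hfm hf hf', EReal.coe_mul]

end ExponentialIntegrals

/-- **Variational lower-bound representation for exponential integrals via Rényi divergence.**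
For a probability measure `ν`, `β, γ ∈ ℝ \ {0}` with `β < γ`, and bounded measurable `g`,
`(1/β) log ∫ e^{βg} dν = inf_θ [ (1/γ) log ∫ e^{γg} dθ + (1/(γ-β)) R_{γ/(γ-β)}(ν‖θ) ]`,
the infimum being over all probability measures `θ`. -/
theorem renyi_inf_representation {S : Type*} [MeasurableSpace S]
    (ν : Measure S) [IsProbabilityMeasure ν]
    (β γ : ℝ) (hβ : β ≠ 0) (hγ : γ ≠ 0) (hβγ : β < γ)
    (g : S → ℝ) (hg : Measurable g) (hgbd : ∃ C : ℝ, ∀ x, |g x| ≤ C) :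
    ((β⁻¹ * Real.log (∫ x, Real.exp (β * g x) ∂ν) : ℝ) : EReal) =
      ⨅ (θ : Measure S) (_ : IsProbabilityMeasure θ),
        ((γ⁻¹ * Real.log (∫ x, Real.exp (γ * g x) ∂θ) : ℝ) : EReal)
          + (((γ - β)⁻¹ : ℝ) : EReal) * renyiDiv (γ / (γ - β)) ν θ := by
  have hd : 0 < γ - β := sub_pos.2 hβγ
  refine le_antisymm (le_iInf₂ fun θ _ ↦ ?_) ?_
  · rw [renyiDiv]
    rcases hγ.lt_or_gt with hγ' | hγ'
    · rw [if_pos (div_neg_of_neg_of_pos hγ' hd)]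
      exact log_integral_exp_le_of_neg hγ' hβγ hg hgbd
    · rw [if_neg (div_pos hγ' hd).not_gt]
      rcases hβ.lt_or_gt with hβ' | hβ'
      · exact log_integral_exp_le_of_neg_of_pos hβ' hγ' hg hgbd
      · exact log_integral_exp_le_of_pos hβ' hβγ hg hgbd
  -- The infimum is attained at the tilt of `ν` by `(β - γ) g`.
  · have hZ := integrable_exp_mul_of_bounded ν hg hgbd (β - γ)
    have hB := integrable_exp_mul_of_bounded ν hg hgbd β
    have hexp : ∀ x, (1 - γ / (γ - β)) * ((β - γ) * g x) = β * g x := fun x ↦ by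
      field_simp
      ring
    have hsum : ∀ x, ((fun x ↦ (β - γ) * g x) + fun x ↦ γ * g x) x = β * g x := fun x ↦ by
      simp only [Pi.add_apply]
      ring
    refine (iInf₂_le (ν.tilted fun x ↦ (β - γ) * g x) (isProbabilityMeasure_tilted hZ)).trans_eq ?_
    rw [renyiDiv_tilted _ ν (hg.const_mul _) hZ (by simpa only [hexp] using hB),
      integral_exp_tilted]
    simp only [hexp, hsum]
    rw [log_div (integral_exp_pos hB).ne' (integral_exp_pos hZ).ne']
    norm_cast
    rw [← mul_assoc, inv_mul_inv_renyi_order hd.ne']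
    field_simp
    ring
end

section
/- Let S be a measurable space, let ν be a probability measure on S, let β, γ ∈ ℝ\{0} with β < γ, and let g : S → ℝ be bounded and measurable. Then the infimum over probability measures θ of [ (1/γ) log ∫_S e^{γg} dθ + (1/(γ−β)) R_{γ/(γ−β)}(ν‖θ) ] is attained at the probability measure θ* defined by dθ* = e^{−(γ−β)g} dν / Z with Z = ∫_S e^{−(γ−β)g} dν, and θ* is the unique minimizer. -/
open MeasureTheory Real ProbabilityTheory
open scoped Classical

open scoped ENNReal

namespace EReal

/-- Multiplication by a real number distributes over sums with a real summand. -/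
lemma coe_mul_coe_add (c t : ℝ) (x : EReal) :
    (c : EReal) * ((t : EReal) + x) = ((c * t : ℝ) : EReal) + (c : EReal) * x := by
  induction x with
  | coe x => norm_cast; ring
  | bot =>
    rcases lt_trichotomy c 0 with hc | rfl | hc
    · rw [add_bot, coe_mul_bot_of_neg hc, coe_add_top]
    · simp
    · simp [coe_mul_bot_of_pos hc]
  | top =>
    rcases lt_trichotomy c 0 with hc | rfl | hc
    · simp [coe_mul_top_of_neg hc]
    · simp
    · rw [coe_add_top, coe_mul_top_of_pos hc, coe_add_top]

lemma eq_zero_of_coe_add_eq_coe {t : ℝ} {y : EReal} (h : (t : EReal) + y = t) : y = 0 := by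
  induction y with
  | bot => simp at h
  | top => simp at h
  | coe y => norm_cast at h ⊢; linarith

end EReal

namespace ENNReal

lemma rpow_lt_ofReal_mul_add {α : ℝ} (h0 : 0 < α) (h1 : α < 1) {x : ℝ≥0∞} (hx : x ≠ ∞)
    (hx1 : x ≠ 1) : x ^ α < ENNReal.ofReal α * x + ENNReal.ofReal (1 - α) := by
  have hy1 : x.toReal - 1 ≠ 0 := fun h => hx1 <| by
    rw [← ENNReal.ofReal_toReal hx, sub_eq_zero.mp h, ENNReal.ofReal_one]
  have hy : 0 ≤ x.toReal := ENNReal.toReal_nonneg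
  have key := rpow_one_add_lt_one_add_mul_self (s := x.toReal - 1) (by linarith) hy1 h0 h1
  rw [← ENNReal.ofReal_toReal hx, ENNReal.ofReal_rpow_of_nonneg hy h0.le,
    ← ENNReal.ofReal_mul h0.le, ← ENNReal.ofReal_add (by positivity) (by linarith),
    ENNReal.ofReal_lt_ofReal_iff_of_nonneg (by positivity)]
  rw [add_sub_cancel] at key
  linarith

lemma ofReal_mul_lt_rpow_add {α : ℝ} (h1 : 1 < α) {x : ℝ≥0∞} (hx : x ≠ ∞)
    (hx1 : x ≠ 1) : ENNReal.ofReal α * x < x ^ α + ENNReal.ofReal (α - 1) := by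
  have hy1 : x.toReal - 1 ≠ 0 := fun h => hx1 <| by
    rw [← ENNReal.ofReal_toReal hx, sub_eq_zero.mp h, ENNReal.ofReal_one]
  have hy : 0 ≤ x.toReal := ENNReal.toReal_nonneg
  have h0 : 0 < α := by linarith
  have key := one_add_mul_self_lt_rpow_one_add (s := x.toReal - 1) (by linarith) hy1 h1
  rw [← ENNReal.ofReal_toReal hx, ENNReal.ofReal_rpow_of_nonneg hy h0.le,
    ← ENNReal.ofReal_mul h0.le, ← ENNReal.ofReal_add (by positivity) (by linarith),
    ENNReal.ofReal_lt_ofReal_iff_of_nonneg (by positivity)]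
  rw [add_sub_cancel] at key
  linarith

end ENNReal

section Renyi

variable {S : Type*} [MeasurableSpace S]

lemma setLIntegral_rnDeriv_div_rpow {α : ℝ} (h0 : 0 < α) (ν θ : Measure S)
    [IsFiniteMeasure ν] [IsFiniteMeasure θ] :
    ∫⁻ x in {x | 0 < ν.rnDeriv (ν + θ) x ∧ 0 < θ.rnDeriv (ν + θ) x},
      (ν.rnDeriv (ν + θ) x / θ.rnDeriv (ν + θ) x) ^ α ∂θ = ∫⁻ x, ν.rnDeriv θ x ^ α ∂θ := by
  have hs : MeasurableSet {x | 0 < ν.rnDeriv (ν + θ) x ∧ 0 < θ.rnDeriv (ν + θ) x} :=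
    (measurableSet_lt measurable_const (Measure.measurable_rnDeriv _ _)).inter
      (measurableSet_lt measurable_const (Measure.measurable_rnDeriv _ _))
  rw [← lintegral_indicator hs]
  refine lintegral_congr_ae ?_
  have hac : θ ≪ ν + θ := rfl.absolutelyContinuous.add_right' _
  filter_upwards [Measure.rnDeriv_eq_div_rnDeriv_add ν θ, Measure.rnDeriv_pos hac] with x hx hq
  rw [hx]
  by_cases hp : 0 < ν.rnDeriv (ν + θ) x
  · rw [Set.indicator_of_mem (Set.mem_ofPred.mpr ⟨hp, hq⟩)]
  · rw [Set.indicator_of_notMem (fun h => hp h.1), nonpos_iff_eq_zero.mp (not_lt.mp hp),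
      ENNReal.zero_div, ENNReal.zero_rpow_of_pos h0]

/-- The Rényi divergence expressed through the Radon–Nikodym derivative of `ν` by `θ`. -/
lemma renyiDivAux_eq {α : ℝ} (h0 : 0 < α) (ν θ : Measure S)
    [IsFiniteMeasure ν] [IsFiniteMeasure θ] :
    renyiDivAux α ν θ = if 1 < α ∧ ¬ ν ≪ θ then ⊤
      else ((α * (α - 1))⁻¹ : ℝ) * ENNReal.log (∫⁻ x, ν.rnDeriv θ x ^ α ∂θ) := by
  rw [renyiDivAux, setLIntegral_rnDeriv_div_rpow h0]

lemma eq_of_rnDeriv_eq_one {ν θ : Measure S} [IsProbabilityMeasure ν] [IsProbabilityMeasure θ]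
    (h : ∀ᵐ x ∂θ, ν.rnDeriv θ x = 1) : ν = θ := by
  have hle := Measure.withDensity_rnDeriv_le ν θ
  rw [withDensity_congr_ae (g := 1) h, withDensity_one] at hle
  exact (Measure.eq_of_le_of_isProbabilityMeasure hle).symm

lemma lintegral_rnDeriv_rpow_le_one {α : ℝ} (h0 : 0 < α) (h1 : α < 1) (ν θ : Measure S)
    [IsProbabilityMeasure ν] [IsProbabilityMeasure θ] :
    ∫⁻ x, ν.rnDeriv θ x ^ α ∂θ ≤ 1 ∧ (∫⁻ x, ν.rnDeriv θ x ^ α ∂θ = 1 → ν = θ) := by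
  have hle : (fun x => ν.rnDeriv θ x ^ α) ≤ᵐ[θ]
      fun x => ENNReal.ofReal α * ν.rnDeriv θ x + ENNReal.ofReal (1 - α) := by
    filter_upwards [ν.rnDeriv_lt_top θ] with x hx
    by_cases hx1 : ν.rnDeriv θ x = 1
    · rw [hx1, ENNReal.one_rpow, mul_one, ← ENNReal.ofReal_add h0.le (by linarith)]
      simp
    · exact (ENNReal.rpow_lt_ofReal_mul_add h0 h1 hx.ne hx1).le
  have hbound : ∫⁻ x, ENNReal.ofReal α * ν.rnDeriv θ x + ENNReal.ofReal (1 - α) ∂θ ≤ 1 := by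
    rw [lintegral_add_right _ measurable_const,
      lintegral_const_mul _ (Measure.measurable_rnDeriv _ _), lintegral_const, measure_univ,
      mul_one]
    calc ENNReal.ofReal α * ∫⁻ x, ν.rnDeriv θ x ∂θ + ENNReal.ofReal (1 - α)
        ≤ ENNReal.ofReal α * 1 + ENNReal.ofReal (1 - α) := by
          gcongr
          exact Measure.lintegral_rnDeriv_le.trans_eq measure_univ
      _ = 1 := by rw [mul_one, ← ENNReal.ofReal_add h0.le (by linarith)]; simp
  refine ⟨(lintegral_mono_ae hle).trans hbound, fun h => eq_of_rnDeriv_eq_one ?_⟩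
  have hae := ae_eq_of_ae_le_of_lintegral_le hle (by simp [h])
    (by fun_prop) (hbound.trans_eq h.symm)
  filter_upwards [hae, ν.rnDeriv_lt_top θ] with x hx hxt
  by_contra hx1
  exact (ENNReal.rpow_lt_ofReal_mul_add h0 h1 hxt.ne hx1).ne hx

lemma one_le_lintegral_rnDeriv_rpow {α : ℝ} (h1 : 1 < α) {ν θ : Measure S}
    [IsProbabilityMeasure ν] [IsProbabilityMeasure θ] (hac : ν ≪ θ) :
    1 ≤ ∫⁻ x, ν.rnDeriv θ x ^ α ∂θ ∧ (∫⁻ x, ν.rnDeriv θ x ^ α ∂θ = 1 → ν = θ) := by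
  have h0 : 0 < α := by linarith
  have hsum : 1 + ENNReal.ofReal (α - 1) = ENNReal.ofReal α := by
    rw [← ENNReal.ofReal_one, ← ENNReal.ofReal_add zero_le_one (by linarith), add_sub_cancel]
  have hle : (fun x => ENNReal.ofReal α * ν.rnDeriv θ x) ≤ᵐ[θ]
      fun x => ν.rnDeriv θ x ^ α + ENNReal.ofReal (α - 1) := by
    filter_upwards [ν.rnDeriv_lt_top θ] with x hx
    by_cases hx1 : ν.rnDeriv θ x = 1
    · rw [hx1, ENNReal.one_rpow, mul_one, hsum]
    · exact (ENNReal.ofReal_mul_lt_rpow_add h1 hx.ne hx1).le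
  have hleft : ∫⁻ x, ENNReal.ofReal α * ν.rnDeriv θ x ∂θ = ENNReal.ofReal α := by
    rw [lintegral_const_mul _ (Measure.measurable_rnDeriv _ _), Measure.lintegral_rnDeriv hac,
      measure_univ, mul_one]
  have hright : ∫⁻ x, ν.rnDeriv θ x ^ α + ENNReal.ofReal (α - 1) ∂θ
      = ∫⁻ x, ν.rnDeriv θ x ^ α ∂θ + ENNReal.ofReal (α - 1) := by
    rw [lintegral_add_right _ measurable_const, lintegral_const, measure_univ, mul_one]
  refine ⟨?_, fun h => eq_of_rnDeriv_eq_one ?_⟩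
  · have := lintegral_mono_ae hle
    rw [hleft, hright, ← hsum] at this
    exact (ENNReal.add_le_add_iff_right ENNReal.ofReal_ne_top).mp this
  have hae := ae_eq_of_ae_le_of_lintegral_le hle (by simp [hleft])
    (by fun_prop) (by rw [hleft, hright, h, hsum])
  filter_upwards [hae, ν.rnDeriv_lt_top θ] with x hx hxt
  by_contra hx1
  exact (ENNReal.ofReal_mul_lt_rpow_add h1 hxt.ne hx1).ne hx

lemma renyiDivAux_self {α : ℝ} (h0 : 0 < α) (ν : Measure S) [IsProbabilityMeasure ν] :
    renyiDivAux α ν ν = 0 := by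
  have h : ∫⁻ x, ν.rnDeriv ν x ^ α ∂ν = 1 := by
    rw [lintegral_congr_ae (g := fun _ => 1)
      (by filter_upwards [ν.rnDeriv_self] with x hx; simp [hx])]
    simp
  rw [renyiDivAux_eq h0, if_neg (fun h => h.2 .rfl), h, ENNReal.log_one, mul_zero]

lemma renyiDivAux_nonneg_and_eq {α : ℝ} (h0 : 0 < α) (h1 : α ≠ 1) (ν θ : Measure S)
    [IsProbabilityMeasure ν] [IsProbabilityMeasure θ] :
    0 ≤ renyiDivAux α ν θ ∧ (renyiDivAux α ν θ = 0 → ν = θ) := by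
  have hc : (((α * (α - 1))⁻¹ : ℝ) : EReal) ≠ 0 := by
    rw [EReal.coe_ne_zero]
    exact inv_ne_zero (mul_ne_zero h0.ne' (sub_ne_zero.mpr h1))
  rw [renyiDivAux_eq h0]
  split_ifs with h
  · simp
  rcases lt_or_gt_of_ne h1 with h1 | h1
  · obtain ⟨hle, heq⟩ := lintegral_rnDeriv_rpow_le_one h0 h1 ν θ
    refine ⟨?_, fun hz => heq ?_⟩
    · refine EReal.mul_nonneg_iff.mpr (.inr ⟨?_, ENNReal.log_le_zero_iff.mpr hle⟩)
      rw [EReal.coe_nonpos]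
      exact inv_nonpos.mpr (mul_nonpos_of_nonneg_of_nonpos h0.le (by linarith))
    · exact ENNReal.log_eq_one_iff.mp ((mul_eq_zero.mp hz).resolve_left hc)
  · have hac : ν ≪ θ := by_contra fun hn => h ⟨h1, hn⟩
    obtain ⟨hle, heq⟩ := one_le_lintegral_rnDeriv_rpow h1 hac
    refine ⟨?_, fun hz => heq ?_⟩
    · refine EReal.mul_nonneg_iff.mpr (.inl ⟨?_, ENNReal.zero_le_log_iff.mpr hle⟩)
      rw [EReal.coe_nonneg]
      exact inv_nonneg.mpr (mul_nonneg h0.le (by linarith))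
    · exact ENNReal.log_eq_one_iff.mp ((mul_eq_zero.mp hz).resolve_left hc)

lemma lintegral_rnDeriv_tilted_rpow {α : ℝ} (h0 : 0 < α) (ν θ : Measure S)
    [IsProbabilityMeasure ν] [IsProbabilityMeasure θ] {a b : S → ℝ} (ha : Measurable a)
    (hνa : Integrable (fun x => exp (a x)) ν) (hθb : Integrable (fun x => exp (b x)) θ)
    (hab : ∀ x, α * a x + (1 - α) * b x = 0) :
    ∫⁻ x, ν.rnDeriv θ x ^ α ∂θ
      = ENNReal.ofReal (exp (α * log (∫ x, exp (a x) ∂ν) + (1 - α) * log (∫ x, exp (b x) ∂θ)))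
        * ∫⁻ x, (ν.tilted a).rnDeriv (θ.tilted b) x ^ α ∂(θ.tilted b) := by
  have hW := integral_exp_pos hνa
  have hG := integral_exp_pos hθb
  set W := ∫ x, exp (a x) ∂ν
  set G := ∫ x, exp (b x) ∂θ
  have := isProbabilityMeasure_tilted hνa
  rw [lintegral_tilted, ← lintegral_const_mul' _ _ ENNReal.ofReal_ne_top]
  refine lintegral_congr_ae ?_
  filter_upwards [rnDeriv_tilted_right (ν.tilted a) θ hθb,
    rnDeriv_tilted_left ν (ν := θ) ha.aemeasurable] with x hr hl
  have hrl : (ν.tilted a).rnDeriv (θ.tilted b) x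
      = ENNReal.ofReal (exp (-b x) * G * (exp (a x) / W)) * ν.rnDeriv θ x := by
    rw [hr, hl, ← mul_assoc, ← ENNReal.ofReal_mul (by positivity)]
  rw [hrl, ENNReal.mul_rpow_of_nonneg _ _ h0.le, ENNReal.ofReal_rpow_of_nonneg (by positivity) h0.le,
    ← mul_assoc, ← mul_assoc, mul_assoc (ENNReal.ofReal _) (ENNReal.ofReal _),
    ← ENNReal.ofReal_mul (by positivity), ← ENNReal.ofReal_mul (by positivity)]
  suffices h : exp (α * log W + (1 - α) * log G)
      * (exp (b x) / G * (exp (-b x) * G * (exp (a x) / W)) ^ α) = 1 by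
    change _ = ENNReal.ofReal (exp (α * log W + (1 - α) * log G)
      * (exp (b x) / G * (exp (-b x) * G * (exp (a x) / W)) ^ α)) * _
    rw [h, ENNReal.ofReal_one, one_mul]
  have hWe : W = exp (log W) := (exp_log hW).symm
  have hGe : G = exp (log G) := (exp_log hG).symm
  generalize log W = w at *
  generalize log G = v at *
  rw [hWe, hGe, ← exp_sub, ← exp_sub, ← exp_add, ← exp_add, ← exp_mul, ← exp_add, ← exp_add,
    exp_eq_one_iff]
  linear_combination hab x

/-- Effect of exponential tilting of both arguments on the Rényi divergence. -/
lemma renyiDivAux_eq_add_tilted {α : ℝ} (h0 : 0 < α) (ν θ : Measure S)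
    [IsProbabilityMeasure ν] [IsProbabilityMeasure θ] {a b : S → ℝ} (ha : Measurable a)
    (hνa : Integrable (fun x => exp (a x)) ν) (hθb : Integrable (fun x => exp (b x)) θ)
    (hab : ∀ x, α * a x + (1 - α) * b x = 0) :
    renyiDivAux α ν θ
      = (((α * (α - 1))⁻¹ *
          (α * log (∫ x, exp (a x) ∂ν) + (1 - α) * log (∫ x, exp (b x) ∂θ)) : ℝ) : EReal)
        + renyiDivAux α (ν.tilted a) (θ.tilted b) := by
  have := isProbabilityMeasure_tilted hνa
  have := isProbabilityMeasure_tilted hθb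
  have hac : ν.tilted a ≪ θ.tilted b ↔ ν ≪ θ :=
    ⟨fun h => ((absolutelyContinuous_tilted hνa).trans h).trans (tilted_absolutelyContinuous θ b),
      fun h => ((tilted_absolutelyContinuous ν a).trans h).trans (absolutelyContinuous_tilted hθb)⟩
  rw [renyiDivAux_eq h0, renyiDivAux_eq h0, hac]
  split_ifs with h
  · rw [EReal.coe_add_top]
  · rw [lintegral_rnDeriv_tilted_rpow h0 ν θ ha hνa hθb hab, ENNReal.log_mul_add,
      ENNReal.log_ofReal_of_pos (exp_pos _), log_exp, EReal.coe_mul_coe_add]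

lemma renyiDiv_eq_add_tilted {α : ℝ} (h0 : α ≠ 0) (ν θ : Measure S)
    [IsProbabilityMeasure ν] [IsProbabilityMeasure θ] {a b : S → ℝ} (ha : Measurable a)
    (hb : Measurable b)
    (hνa : Integrable (fun x => exp (a x)) ν) (hθb : Integrable (fun x => exp (b x)) θ)
    (hab : ∀ x, α * a x + (1 - α) * b x = 0) :
    renyiDiv α ν θ
      = (((α * (α - 1))⁻¹ *
          (α * log (∫ x, exp (a x) ∂ν) + (1 - α) * log (∫ x, exp (b x) ∂θ)) : ℝ) : EReal)
        + renyiDiv α (ν.tilted a) (θ.tilted b) := by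
  unfold renyiDiv
  split_ifs with h
  · rw [renyiDivAux_eq_add_tilted (by linarith) θ ν hb hθb hνa
      (fun x => by linear_combination hab x)]
    congr 3 <;> ring
  · exact renyiDivAux_eq_add_tilted (lt_of_le_of_ne (not_lt.mp h) h0.symm) ν θ ha hνa hθb hab

lemma renyiDiv_self {α : ℝ} (h0 : α ≠ 0) (ν : Measure S) [IsProbabilityMeasure ν] :
    renyiDiv α ν ν = 0 := by
  unfold renyiDiv
  split_ifs with h
  · exact renyiDivAux_self (by linarith) ν
  · exact renyiDivAux_self (lt_of_le_of_ne (not_lt.mp h) h0.symm) ν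

lemma renyiDiv_nonneg_and_eq {α : ℝ} (h0 : α ≠ 0) (h1 : α ≠ 1) (ν θ : Measure S)
    [IsProbabilityMeasure ν] [IsProbabilityMeasure θ] :
    0 ≤ renyiDiv α ν θ ∧ (renyiDiv α ν θ = 0 → ν = θ) := by
  unfold renyiDiv
  split_ifs with h
  · obtain ⟨hnn, heq⟩ := renyiDivAux_nonneg_and_eq (α := 1 - α) (by linarith)
      (fun h => h0 (by linarith)) θ ν
    exact ⟨hnn, fun hz => (heq hz).symm⟩
  · exact renyiDivAux_nonneg_and_eq (lt_of_le_of_ne (not_lt.mp h) h0.symm) h1 ν θ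

lemma integrable_exp_const_mul_of_bounded (μ : Measure S) [IsFiniteMeasure μ] {g : S → ℝ}
    (hg : Measurable g) (hgbd : ∃ C : ℝ, ∀ x, |g x| ≤ C) (c : ℝ) :
    Integrable (fun x => exp (c * g x)) μ := by
  obtain ⟨C, hC⟩ := hgbd
  refine Integrable.of_bound (by fun_prop) (exp (|c| * C)) (ae_of_all _ fun x => ?_)
  rw [norm_eq_abs, abs_exp, exp_le_exp]
  calc c * g x ≤ |c * g x| := le_abs_self _
    _ = |c| * |g x| := abs_mul _ _
    _ ≤ |c| * C := by gcongr; exact hC x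

end Renyi

/-- **Attainment and uniqueness of the minimizer in the Rényi variational formula.**
The infimum of `θ ↦ (1/γ) log ∫ e^{γg} dθ + (1/(γ-β)) R_{γ/(γ-β)}(ν‖θ)` over probability
measures is uniquely attained at `dθ* = e^{-(γ-β)g} dν / Z`, `Z = ∫ e^{-(γ-β)g} dν`. -/
theorem renyi_inf_attained_uniquely {S : Type*} [MeasurableSpace S]
    (ν : Measure S) [IsProbabilityMeasure ν]
    (β γ : ℝ) (hβ : β ≠ 0) (hγ : γ ≠ 0) (hβγ : β < γ)
    (g : S → ℝ) (hg : Measurable g) (hgbd : ∃ C : ℝ, ∀ x, |g x| ≤ C)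
    (Z : ℝ) (hZ : Z = ∫ x, Real.exp (-(γ - β) * g x) ∂ν)
    (θstar : Measure S)
    (hθstar : θstar = ν.withDensity fun x => ENNReal.ofReal (Real.exp (-(γ - β) * g x) / Z))
    (F : Measure S → EReal)
    (hF : F = fun θ : Measure S =>
      ((γ⁻¹ * Real.log (∫ x, Real.exp (γ * g x) ∂θ) : ℝ) : EReal)
        + (((γ - β)⁻¹ : ℝ) : EReal) * renyiDiv (γ / (γ - β)) ν θ) :
    IsProbabilityMeasure θstar ∧
      F θstar = (⨅ (θ : Measure S) (_ : IsProbabilityMeasure θ), F θ) ∧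
      ∀ θ : Measure S, IsProbabilityMeasure θ → F θ = F θstar → θ = θstar := by
  have hδ : 0 < γ - β := sub_pos.mpr hβγ
  have hα0 : γ / (γ - β) ≠ 0 := div_ne_zero hγ hδ.ne'
  have hα1 : γ / (γ - β) ≠ 1 := fun h => hβ (by rw [div_eq_one_iff_eq hδ.ne'] at h; linarith)
  have hint (μ : Measure S) [IsFiniteMeasure μ] (c : ℝ) : Integrable (fun x => exp (c * g x)) μ :=
    integrable_exp_const_mul_of_bounded μ hg hgbd c
  have hstar : θstar = ν.tilted (fun x => -(γ - β) * g x) := by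
    rw [hθstar, hZ, Measure.tilted]
  have hprob : IsProbabilityMeasure θstar := hstar ▸ isProbabilityMeasure_tilted (hint ν _)
  have := isProbabilityMeasure_tilted (hint ν β)
  have hFeq (θ : Measure S) [IsProbabilityMeasure θ] :
      F θ = ((β⁻¹ * log (∫ x, exp (β * g x) ∂ν) : ℝ) : EReal) + (((γ - β)⁻¹ : ℝ) : EReal) *
        renyiDiv (γ / (γ - β)) (ν.tilted fun x => β * g x) (θ.tilted fun x => γ * g x) := by
    rw [hF]
    dsimp only
    rw [renyiDiv_eq_add_tilted hα0 ν θ (hg.const_mul β) (hg.const_mul γ) (hint ν β) (hint θ γ)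
      (fun x => by field_simp; ring), EReal.coe_mul_coe_add, ← add_assoc, ← EReal.coe_add]
    congr 2
    have : γ / (γ - β) - 1 = β / (γ - β) := by field_simp; ring
    rw [← neg_sub (γ / (γ - β)) 1, this]
    field_simp
    ring
  have htilt : θstar.tilted (fun x => γ * g x) = ν.tilted fun x => β * g x := by
    rw [hstar, tilted_tilted (hint ν _)]
    congr 1
    funext x
    simp only [Pi.add_apply]
    ring
  have hFstar : F θstar = ((β⁻¹ * log (∫ x, exp (β * g x) ∂ν) : ℝ) : EReal) := by
    rw [hFeq, htilt, renyiDiv_self hα0, mul_zero, add_zero]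
  refine ⟨hprob, le_antisymm (le_iInf₂ fun θ hθ => ?_) (iInf₂_le θstar hprob), fun θ hθ h => ?_⟩
  · have := isProbabilityMeasure_tilted (hint θ γ)
    rw [hFstar, hFeq θ]
    refine le_add_of_nonneg_right (mul_nonneg ?_ (renyiDiv_nonneg_and_eq hα0 hα1 _ _).1)
    exact EReal.coe_nonneg.mpr (inv_nonneg.mpr hδ.le)
  · have := isProbabilityMeasure_tilted (hint θ γ)
    rw [hFstar, hFeq θ] at h
    have hz : (((γ - β)⁻¹ : ℝ) : EReal) * renyiDiv (γ / (γ - β))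
        (ν.tilted fun x => β * g x) (θ.tilted fun x => γ * g x) = 0 :=
      EReal.eq_zero_of_coe_add_eq_coe h
    have heq := (renyiDiv_nonneg_and_eq hα0 hα1 _ _).2 ((mul_eq_zero.mp hz).resolve_left
      (EReal.coe_ne_zero.mpr (inv_ne_zero hδ.ne')))
    rw [← tilted_neg_same (hint θ γ), ← heq, ← htilt, tilted_neg_same (hint θstar γ)]
end

section
/- Let S be a measurable space, let ν be a probability measure on S, let α ∈ ℝ with α ≠ 0 and α ≠ 1, and let g : S → ℝ be bounded and measurable. Then (1/(α−1)) log ∫_S e^{(α−1)g} dν = inf over all probability measures θ on S of [ (1/α) log ∫_S e^{αg} dθ + R_α(ν‖θ) ]. -/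
open MeasureTheory Real ProbabilityTheory
open scoped Classical

section RenyiVariational

open scoped ENNReal

variable {S : Type*} [MeasurableSpace S]

/-- The set where both densities with respect to `ν + θ` are positive. -/
def renyiSupport (ν θ : Measure S) : Set S :=
  {x | 0 < ν.rnDeriv (ν + θ) x ∧ 0 < θ.rnDeriv (ν + θ) x}

/-- The ratio of the densities of `ν` and `θ` with respect to `ν + θ`. -/
noncomputable def renyiRatio (ν θ : Measure S) (x : S) : ℝ≥0∞ :=
  ν.rnDeriv (ν + θ) x / θ.rnDeriv (ν + θ) x

lemma measurableSet_renyiSupport (ν θ : Measure S) : MeasurableSet (renyiSupport ν θ) :=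
  (measurableSet_lt measurable_const (Measure.measurable_rnDeriv _ _)).inter
    (measurableSet_lt measurable_const (Measure.measurable_rnDeriv _ _))

lemma measurable_renyiRatio (ν θ : Measure S) : Measurable (renyiRatio ν θ) :=
  (Measure.measurable_rnDeriv _ _).div (Measure.measurable_rnDeriv _ _)

lemma ae_mem_renyiSupport_left {ν θ : Measure S} [IsFiniteMeasure ν] [IsFiniteMeasure θ]
    (h : ν ≪ θ) : ∀ᵐ x ∂ν, x ∈ renyiSupport ν θ := by
  filter_upwards [Measure.rnDeriv_pos (absolutelyContinuous_add_left ν θ),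
    h.ae_le (Measure.rnDeriv_pos (absolutelyContinuous_add_right ν θ))] with x h1 h2
  exact ⟨h1, h2⟩

lemma ae_mem_renyiSupport_right {ν θ : Measure S} [IsFiniteMeasure ν] [IsFiniteMeasure θ]
    (h : θ ≪ ν) : ∀ᵐ x ∂θ, x ∈ renyiSupport ν θ := by
  filter_upwards [h.ae_le (Measure.rnDeriv_pos (absolutelyContinuous_add_left ν θ)),
    Measure.rnDeriv_pos (absolutelyContinuous_add_right ν θ)] with x h1 h2
  exact ⟨h1, h2⟩

/-- On the common support, `ν` has density `renyiRatio ν θ` with respect to `θ`. -/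
lemma restrict_renyiSupport_eq_withDensity (ν θ : Measure S)
    [IsFiniteMeasure ν] [IsFiniteMeasure θ] :
    ν.restrict (renyiSupport ν θ) =
      (θ.restrict (renyiSupport ν θ)).withDensity (renyiRatio ν θ) := by
  have hA := measurableSet_renyiSupport ν θ
  have h1 := Measure.withDensity_rnDeriv_eq ν (ν + θ) (absolutelyContinuous_add_left ν θ)
  have h2 := Measure.withDensity_rnDeriv_eq θ (ν + θ) (absolutelyContinuous_add_right ν θ)
  have e1 : ν.restrict (renyiSupport ν θ) =
      ((ν + θ).restrict (renyiSupport ν θ)).withDensity (ν.rnDeriv (ν + θ)) := by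
    rw [← restrict_withDensity hA, h1]
  have e2 : θ.restrict (renyiSupport ν θ) =
      ((ν + θ).restrict (renyiSupport ν θ)).withDensity (θ.rnDeriv (ν + θ)) := by
    rw [← restrict_withDensity hA, h2]
  rw [e1, e2, ← withDensity_mul _ (Measure.measurable_rnDeriv _ _) (measurable_renyiRatio ν θ)]
  refine withDensity_congr_ae ?_
  filter_upwards [ae_restrict_mem hA, ae_restrict_of_ae (Measure.rnDeriv_lt_top θ (ν + θ))]
    with x hx htop
  exact (ENNReal.mul_div_cancel hx.2.ne' htop.ne).symm

lemma setLIntegral_renyiSupport (ν θ : Measure S) [IsFiniteMeasure ν] [IsFiniteMeasure θ]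
    {f : S → ℝ≥0∞} (hf : Measurable f) :
    ∫⁻ x in renyiSupport ν θ, f x ∂ν =
      ∫⁻ x in renyiSupport ν θ, renyiRatio ν θ x * f x ∂θ := by
  conv_lhs => rw [restrict_renyiSupport_eq_withDensity]
  exact lintegral_withDensity_eq_lintegral_mul _ (measurable_renyiRatio ν θ) hf

lemma renyiDivAux_of_not {β : ℝ} {ν θ : Measure S} (h : ¬ (1 < β ∧ ¬ ν ≪ θ)) :
    renyiDivAux β ν θ = ((β * (β - 1))⁻¹ : ℝ) *
      ENNReal.log (∫⁻ x in renyiSupport ν θ, renyiRatio ν θ x ^ β ∂θ) :=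
  if_neg h

lemma integrable_exp_of_abs_le {ν : Measure S} [IsFiniteMeasure ν] {g : S → ℝ}
    (hg : Measurable g) {C : ℝ} (hC : ∀ x, |g x| ≤ C) (c : ℝ) :
    Integrable (fun x => Real.exp (c * g x)) ν := by
  refine Integrable.of_bound (by fun_prop) (Real.exp (|c| * C)) (ae_of_all _ fun x => ?_)
  rw [Real.norm_eq_abs, Real.abs_exp]
  refine Real.exp_le_exp.2 ((le_abs_self _).trans ?_)
  rw [abs_mul]
  exact mul_le_mul_of_nonneg_left (hC x) (abs_nonneg c)

lemma log_lintegral_exp {ν : Measure S} [NeZero ν] {f : S → ℝ}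
    (hf : Integrable (fun x => Real.exp (f x)) ν) :
    ENNReal.log (∫⁻ x, ENNReal.ofReal (Real.exp (f x)) ∂ν) =
      (Real.log (∫ x, Real.exp (f x) ∂ν) : ℝ) := by
  rw [← ofReal_integral_eq_lintegral_ofReal hf (ae_of_all _ fun x => (Real.exp_pos _).le),
    ENNReal.log_ofReal_of_pos (integral_exp_pos hf)]

/-- Hölder's inequality for the order-`β` integral, `β > 1`. -/
lemma lintegral_exp_le_mul_renyi {β : ℝ} (hβ : 1 < β) {ν θ : Measure S}
    [IsFiniteMeasure ν] [IsFiniteMeasure θ] (h : ν ≪ θ) {g : S → ℝ} (hg : Measurable g) :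
    ∫⁻ x, ENNReal.ofReal (Real.exp ((β - 1) * g x)) ∂ν ≤
      (∫⁻ x, ENNReal.ofReal (Real.exp (β * g x)) ∂θ) ^ ((β - 1) / β) *
        (∫⁻ x in renyiSupport ν θ, renyiRatio ν θ x ^ β ∂θ) ^ β⁻¹ := by
  have hβ0 : 0 < β := by linarith
  have hr := measurable_renyiRatio ν θ
  calc ∫⁻ x, ENNReal.ofReal (Real.exp ((β - 1) * g x)) ∂ν
      = ∫⁻ x in renyiSupport ν θ, ENNReal.ofReal (Real.exp ((β - 1) * g x)) ∂ν := by
        rw [Measure.restrict_eq_self_of_ae_mem (ae_mem_renyiSupport_left h)]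
    _ = ∫⁻ x in renyiSupport ν θ,
          renyiRatio ν θ x * ENNReal.ofReal (Real.exp ((β - 1) * g x)) ∂θ :=
        setLIntegral_renyiSupport ν θ (by fun_prop)
    _ = ∫⁻ x in renyiSupport ν θ, ENNReal.ofReal (Real.exp (β * g x)) ^ ((β - 1) / β) *
          (renyiRatio ν θ x ^ β) ^ β⁻¹ ∂θ := by
        refine lintegral_congr fun x => ?_
        rw [← ENNReal.rpow_mul, mul_inv_cancel₀ hβ0.ne', ENNReal.rpow_one, mul_comm,
          ENNReal.ofReal_rpow_of_pos (Real.exp_pos _), ← Real.exp_mul]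
        congr 3
        field_simp
    _ ≤ (∫⁻ x in renyiSupport ν θ, ENNReal.ofReal (Real.exp (β * g x)) ∂θ) ^ ((β - 1) / β) *
          (∫⁻ x in renyiSupport ν θ, renyiRatio ν θ x ^ β ∂θ) ^ β⁻¹ :=
        ENNReal.lintegral_mul_norm_pow_le (by fun_prop) (by fun_prop)
          (div_nonneg (by linarith) hβ0.le) (by positivity) (by field_simp; ring)
    _ ≤ _ := by
        gcongr
        exact Measure.restrict_le_self

/-- Hölder's inequality for the order-`β` integral, `0 < β < 1`. -/
lemma renyi_le_mul_lintegral_exp {β : ℝ} (hβ0 : 0 < β) (hβ : β < 1) (ν θ : Measure S)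
    [IsFiniteMeasure ν] [IsFiniteMeasure θ] {g : S → ℝ} (hg : Measurable g) :
    ∫⁻ x in renyiSupport ν θ, renyiRatio ν θ x ^ β ∂θ ≤
      (∫⁻ x, ENNReal.ofReal (Real.exp ((β - 1) * g x)) ∂ν) ^ β *
        (∫⁻ x, ENNReal.ofReal (Real.exp (β * g x)) ∂θ) ^ (1 - β) := by
  have hr := measurable_renyiRatio ν θ
  calc ∫⁻ x in renyiSupport ν θ, renyiRatio ν θ x ^ β ∂θ
      = ∫⁻ x in renyiSupport ν θ,
          (renyiRatio ν θ x * ENNReal.ofReal (Real.exp ((β - 1) * g x))) ^ β *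
            ENNReal.ofReal (Real.exp (β * g x)) ^ (1 - β) ∂θ := by
        refine lintegral_congr fun x => ?_
        rw [ENNReal.mul_rpow_of_nonneg _ _ hβ0.le, mul_assoc,
          ENNReal.ofReal_rpow_of_pos (Real.exp_pos _), ENNReal.ofReal_rpow_of_pos (Real.exp_pos _),
          ← ENNReal.ofReal_mul (by positivity), ← Real.exp_mul, ← Real.exp_mul, ← Real.exp_add]
        ring_nf
        simp
    _ ≤ (∫⁻ x in renyiSupport ν θ,
          renyiRatio ν θ x * ENNReal.ofReal (Real.exp ((β - 1) * g x)) ∂θ) ^ β *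
        (∫⁻ x in renyiSupport ν θ, ENNReal.ofReal (Real.exp (β * g x)) ∂θ) ^ (1 - β) :=
        ENNReal.lintegral_mul_norm_pow_le (by fun_prop) (by fun_prop)
          hβ0.le (by linarith) (by ring)
    _ = (∫⁻ x in renyiSupport ν θ, ENNReal.ofReal (Real.exp ((β - 1) * g x)) ∂ν) ^ β *
        (∫⁻ x in renyiSupport ν θ, ENNReal.ofReal (Real.exp (β * g x)) ∂θ) ^ (1 - β) := by
        rw [← setLIntegral_renyiSupport ν θ (by fun_prop)]
    _ ≤ _ := by
        gcongr
        · exact Measure.restrict_le_self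
        · exact Measure.restrict_le_self

/-- The variational lower bound for positive orders. -/
lemma log_integral_exp_le_add_renyiDivAux {β : ℝ} (hβ0 : 0 < β) (hβ1 : β ≠ 1) (ν θ : Measure S)
    [IsProbabilityMeasure ν] [IsProbabilityMeasure θ] {g : S → ℝ} (hg : Measurable g)
    {C : ℝ} (hC : ∀ x, |g x| ≤ C) :
    (((β - 1)⁻¹ * Real.log (∫ x, Real.exp ((β - 1) * g x) ∂ν) : ℝ) : EReal) ≤
      ((β⁻¹ * Real.log (∫ x, Real.exp (β * g x) ∂θ) : ℝ) : EReal) + renyiDivAux β ν θ := by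
  by_cases hac : 1 < β ∧ ¬ ν ≪ θ
  · rw [renyiDivAux, if_pos hac, EReal.add_top_of_ne_bot (EReal.coe_ne_bot _)]
    exact le_top
  rw [renyiDivAux_of_not hac]
  have hi := log_lintegral_exp (integrable_exp_of_abs_le (ν := ν) hg hC (β - 1))
  have hj := log_lintegral_exp (integrable_exp_of_abs_le (ν := θ) hg hC β)
  rcases hβ1.lt_or_gt with hβ | hβ
  · have key := ENNReal.log_le_log (renyi_le_mul_lintegral_exp hβ0 hβ ν θ hg)
    rw [ENNReal.log_mul_add, ENNReal.log_rpow, ENNReal.log_rpow, hi, hj] at key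
    have hneg : (β * (β - 1))⁻¹ < 0 := inv_lt_zero.2 (mul_neg_of_pos_of_neg hβ0 (by linarith))
    generalize ENNReal.log (∫⁻ x in renyiSupport ν θ, renyiRatio ν θ x ^ β ∂θ) = k at key ⊢
    generalize Real.log (∫ x, Real.exp ((β - 1) * g x) ∂ν) = i at key ⊢
    generalize Real.log (∫ x, Real.exp (β * g x) ∂θ) = j at key ⊢
    norm_cast at key
    induction k with
    | bot => rw [EReal.coe_mul_bot_of_neg hneg, EReal.add_top_of_ne_bot (EReal.coe_ne_bot _)]
             exact le_top
    | top => exact absurd key (not_le.2 (EReal.coe_lt_top _))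
    | coe k =>
      norm_cast at key ⊢
      have h := mul_le_mul_of_nonpos_left key hneg.le
      have hβ' : β - 1 ≠ 0 := by linarith
      have e : (β * (β - 1))⁻¹ * (β * i + (1 - β) * j) = (β - 1)⁻¹ * i - β⁻¹ * j := by
        field_simp; ring
      linarith
  · have hνθ : ν ≪ θ := by tauto
    have key := ENNReal.log_le_log (lintegral_exp_le_mul_renyi hβ hνθ hg)
    rw [ENNReal.log_mul_add, ENNReal.log_rpow, ENNReal.log_rpow, hi, hj] at key
    have hpos : 0 < (β * (β - 1))⁻¹ := inv_pos.2 (mul_pos hβ0 (by linarith))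
    generalize ENNReal.log (∫⁻ x in renyiSupport ν θ, renyiRatio ν θ x ^ β ∂θ) = k at key ⊢
    generalize Real.log (∫ x, Real.exp ((β - 1) * g x) ∂ν) = i at key ⊢
    generalize Real.log (∫ x, Real.exp (β * g x) ∂θ) = j at key ⊢
    induction k with
    | bot =>
      rw [EReal.coe_mul_bot_of_pos (inv_pos.2 hβ0), EReal.add_bot] at key
      exact absurd key (not_le.2 (EReal.bot_lt_coe _))
    | top => rw [EReal.coe_mul_top_of_pos hpos, EReal.add_top_of_ne_bot (EReal.coe_ne_bot _)]
             exact le_top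
    | coe k =>
      norm_cast at key ⊢
      have hβ' : 0 < β - 1 := by linarith
      have h := mul_le_mul_of_nonneg_left key (inv_pos.2 hβ').le
      have e : (β - 1)⁻¹ * ((β - 1) / β * j + β⁻¹ * k) = β⁻¹ * j + (β * (β - 1))⁻¹ * k := by
        field_simp
      linarith

/-- The Rényi divergence of an exponentially tilted measure from the original one. -/
lemma renyiDivAux_tilted_left (β : ℝ) (θ : Measure S) [IsProbabilityMeasure θ] {f : S → ℝ}
    (hf : Measurable f) {C : ℝ} (hC : ∀ x, |f x| ≤ C) :
    renyiDivAux β (θ.tilted f) θ = (((β * (β - 1))⁻¹ *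
      (Real.log (∫ x, Real.exp (β * f x) ∂θ) - β * Real.log (∫ x, Real.exp (f x) ∂θ)) : ℝ) :
        EReal) := by
  have hint : Integrable (fun x => Real.exp (f x)) θ := by
    simpa using integrable_exp_of_abs_le (ν := θ) hf hC 1
  have hintβ := integrable_exp_of_abs_le (ν := θ) hf hC β
  have hprob := isProbabilityMeasure_tilted hint
  have hZ := integral_exp_pos hint
  have hac := tilted_absolutelyContinuous θ f
  have hA := Measure.restrict_eq_self_of_ae_mem
    (ae_mem_renyiSupport_right (absolutelyContinuous_tilted hint))
  have hA' := Measure.restrict_eq_self_of_ae_mem (ae_mem_renyiSupport_left hac)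
  have hr : renyiRatio (θ.tilted f) θ =ᵐ[θ]
      fun x => ENNReal.ofReal (Real.exp (f x) / ∫ x, Real.exp (f x) ∂θ) := by
    have h := restrict_renyiSupport_eq_withDensity (θ.tilted f) θ
    rw [hA, hA'] at h
    exact (withDensity_eq_iff_of_sigmaFinite (measurable_renyiRatio _ _).aemeasurable
      (by fun_prop)).1 h.symm
  rw [renyiDivAux_of_not (fun h => h.2 hac), hA]
  have hK : ∫⁻ x, renyiRatio (θ.tilted f) θ x ^ β ∂θ =
      ENNReal.ofReal ((∫ x, Real.exp (β * f x) ∂θ) / (∫ x, Real.exp (f x) ∂θ) ^ β) := by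
    rw [← integral_div, ofReal_integral_eq_lintegral_ofReal (hintβ.div_const _)
      (ae_of_all _ fun x => by positivity)]
    refine lintegral_congr_ae ?_
    filter_upwards [hr] with x hx
    rw [hx, ENNReal.ofReal_rpow_of_pos (by positivity),
      Real.div_rpow (Real.exp_pos _).le hZ.le, ← Real.exp_mul, mul_comm]
  have hJ := integral_exp_pos hintβ
  rw [hK, ENNReal.log_ofReal_of_pos (by positivity), Real.log_div hJ.ne' (by positivity),
    Real.log_rpow hZ, ← EReal.coe_mul]

/-- The variational lower bound for all orders. -/
lemma log_integral_exp_le_add_renyiDiv {α : ℝ} (hα0 : α ≠ 0) (hα1 : α ≠ 1) (ν θ : Measure S)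
    [IsProbabilityMeasure ν] [IsProbabilityMeasure θ] {g : S → ℝ} (hg : Measurable g)
    {C : ℝ} (hC : ∀ x, |g x| ≤ C) :
    (((α - 1)⁻¹ * Real.log (∫ x, Real.exp ((α - 1) * g x) ∂ν) : ℝ) : EReal) ≤
      ((α⁻¹ * Real.log (∫ x, Real.exp (α * g x) ∂θ) : ℝ) : EReal) + renyiDiv α ν θ := by
  rcases hα0.lt_or_gt with hneg | hpos
  · have h := log_integral_exp_le_add_renyiDivAux (β := 1 - α) (by linarith) (by simpa using hα0)
      θ ν hg.neg (C := C) (by simpa using hC)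
    rw [renyiDiv, if_pos hneg]
    have e1 : ∀ x, (1 - α - 1) * (-g) x = α * g x := fun x => by simp
    have e2 : ∀ x, (1 - α) * (-g) x = (α - 1) * g x := fun x => by simp; ring
    have e3 : (1 - α - 1)⁻¹ = -α⁻¹ := by rw [← inv_neg]; ring_nf
    have e4 : (1 - α)⁻¹ = -(α - 1)⁻¹ := by rw [← inv_neg]; ring_nf
    simp only [e1, e2, e3, e4] at h
    generalize renyiDivAux (1 - α) θ ν = r at h ⊢
    induction r with
    | bot => rw [EReal.add_bot] at h; exact absurd h (not_le.2 (EReal.bot_lt_coe _))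
    | top => rw [EReal.add_top_of_ne_bot (EReal.coe_ne_bot _)]; exact le_top
    | coe r => norm_cast at h ⊢; linarith
  · rw [renyiDiv, if_neg hpos.not_gt]
    exact log_integral_exp_le_add_renyiDivAux hpos hα1 ν θ hg hC

/-- The variational lower bound is attained at `ν.tilted (-g)`. -/
lemma log_integral_exp_eq_add_renyiDiv_tilted {α : ℝ} (hα0 : α ≠ 0) (hα1 : α ≠ 1)
    (ν : Measure S) [IsProbabilityMeasure ν] {g : S → ℝ} (hg : Measurable g)
    {C : ℝ} (hC : ∀ x, |g x| ≤ C) :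
    (((α - 1)⁻¹ * Real.log (∫ x, Real.exp ((α - 1) * g x) ∂ν) : ℝ) : EReal) =
      ((α⁻¹ * Real.log (∫ x, Real.exp (α * g x) ∂(ν.tilted (-g))) : ℝ) : EReal) +
        renyiDiv α ν (ν.tilted (-g)) := by
  have hα1' : α - 1 ≠ 0 := sub_ne_zero.2 hα1
  have hint : Integrable (fun x => Real.exp ((-g) x)) ν := by
    simpa using integrable_exp_of_abs_le (ν := ν) hg hC (-1)
  have hprob := isProbabilityMeasure_tilted hint
  have hI := integral_exp_pos (integrable_exp_of_abs_le (ν := ν) hg hC (α - 1))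
  have hZ := integral_exp_pos hint
  have e1 : ∫ x, Real.exp (α * g x) ∂(ν.tilted (-g)) =
      (∫ x, Real.exp ((α - 1) * g x) ∂ν) / ∫ x, Real.exp ((-g) x) ∂ν := by
    rw [integral_exp_tilted (-g) fun x => α * g x]
    congr! 4 with x
    simp; ring
  rcases hα0.lt_or_gt with hneg | hpos
  · rw [renyiDiv, if_pos hneg, renyiDivAux_tilted_left _ _ hg.neg (C := C) (by simpa using hC),
      e1, Real.log_div hI.ne' hZ.ne', ← EReal.coe_add]
    have e2 : ∀ x, (1 - α) * (-g) x = (α - 1) * g x := fun x => by simp; ring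
    have e3 : ((1 - α) * (1 - α - 1))⁻¹ = (α * (α - 1))⁻¹ := by ring_nf
    simp only [e2, e3]
    congr 1
    field_simp
    ring
  · have hν : (ν.tilted (-g)).tilted g = ν := by
      simpa using tilted_neg_same hint
    have e2 : ∫ x, Real.exp (g x) ∂(ν.tilted (-g)) = (∫ x, Real.exp ((-g) x) ∂ν)⁻¹ := by
      rw [integral_exp_tilted (-g) g]
      simp
    have h := renyiDivAux_tilted_left α (ν.tilted (-g)) hg hC
    rw [hν] at h
    rw [renyiDiv, if_neg hpos.not_gt, h, e1, e2, Real.log_div hI.ne' hZ.ne', Real.log_inv,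
      ← EReal.coe_add]
    congr 1
    field_simp
    ring

end RenyiVariational

/-- **Infimum representation, order-`α` form.** For a probability measure `ν`, `α ∈ ℝ \ {0,1}`,
and bounded measurable `g`,
`(1/(α-1)) log ∫ e^{(α-1)g} dν = inf_θ [ (1/α) log ∫ e^{αg} dθ + R_α(ν‖θ) ]`,
the infimum being over all probability measures `θ`. -/
theorem renyi_inf_representation_alpha {S : Type*} [MeasurableSpace S]
    (ν : Measure S) [IsProbabilityMeasure ν]
    (α : ℝ) (hα0 : α ≠ 0) (hα1 : α ≠ 1)
    (g : S → ℝ) (hg : Measurable g) (hgbd : ∃ C : ℝ, ∀ x, |g x| ≤ C) :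
    (((α - 1)⁻¹ * Real.log (∫ x, Real.exp ((α - 1) * g x) ∂ν) : ℝ) : EReal) =
      ⨅ (θ : Measure S) (_ : IsProbabilityMeasure θ),
        ((α⁻¹ * Real.log (∫ x, Real.exp (α * g x) ∂θ) : ℝ) : EReal)
          + renyiDiv α ν θ := by
  obtain ⟨C, hC⟩ := hgbd
  refine le_antisymm
    (le_iInf₂ fun θ _ => log_integral_exp_le_add_renyiDiv hα0 hα1 ν θ hg hC) ?_
  have hint : Integrable (fun x => Real.exp ((-g) x)) ν := by
    simpa using integrable_exp_of_abs_le (ν := ν) hg hC (-1)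
  rw [log_integral_exp_eq_add_renyiDiv_tilted hα0 hα1 ν hg hC]
  exact iInf₂_le (ν.tilted (-g)) (isProbabilityMeasure_tilted hint)
end

section
/- Let S be a measurable space, let θ and ν be probability measures on S, let α > 1, and let g : S → ℝ be any measurable function (not necessarily bounded). Then (1/(α−1)) log ∫_S e^{(α−1)g} dθ ≤ (1/α) log ∫_S e^{αg} dν + R_α(θ‖ν), where the inequality is interpreted in [−∞, +∞] (in particular, if the right-hand side is finite then e^{(α−1)g} is θ-integrable and the inequality holds with finite left-hand side). -/
open MeasureTheory Real ProbabilityTheory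
open scoped Classical

open scoped ENNReal

section

variable {S : Type*} [MeasurableSpace S]

/-- Integration against `θ ≪ ν` as integration against `ν`, through the densities of both measures
with respect to `θ + ν`. -/
lemma lintegral_eq_setLIntegral_mul_rnDeriv_div (θ ν : Measure S) [SigmaFinite θ] [SigmaFinite ν]
    (h : θ ≪ ν) {f : S → ℝ≥0∞} (hf : Measurable f) :
    ∫⁻ x, f x ∂θ =
      ∫⁻ x in {x | 0 < θ.rnDeriv (θ + ν) x ∧ 0 < ν.rnDeriv (θ + ν) x},
        θ.rnDeriv (θ + ν) x / ν.rnDeriv (θ + ν) x * f x ∂ν := by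
  have hθ : θ ≪ θ + ν := Measure.AbsolutelyContinuous.rfl.add_right ν
  have hν : ν ≪ θ + ν := by
    rw [add_comm]; exact Measure.AbsolutelyContinuous.rfl.add_right θ
  have hθm := Measure.measurable_rnDeriv θ (θ + ν)
  have hνm := Measure.measurable_rnDeriv ν (θ + ν)
  set E : Set S := {x | 0 < θ.rnDeriv (θ + ν) x ∧ 0 < ν.rnDeriv (θ + ν) x}
  have hE : MeasurableSet E :=
    (measurableSet_lt measurable_const hθm).inter (measurableSet_lt measurable_const hνm)
  have hθE : ∀ᵐ x ∂θ, x ∈ E :=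
    (Measure.rnDeriv_pos hθ).and (h.ae_le (Measure.rnDeriv_pos hν))
  calc ∫⁻ x, f x ∂θ = ∫⁻ x in E, f x ∂θ := by rw [Measure.restrict_eq_self_of_ae_mem hθE]
    _ = ∫⁻ x in E, θ.rnDeriv (θ + ν) x * f x ∂(θ + ν) :=
        (setLIntegral_rnDeriv_mul hθ hf.aemeasurable hE).symm
    _ = ∫⁻ x in E, ν.rnDeriv (θ + ν) x *
          (θ.rnDeriv (θ + ν) x / ν.rnDeriv (θ + ν) x * f x) ∂(θ + ν) := by
        refine setLIntegral_congr_fun_ae hE ?_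
        filter_upwards [Measure.rnDeriv_lt_top ν (θ + ν)] with x hx hxE
        rw [← mul_assoc, ENNReal.mul_div_cancel hxE.2.ne' hx.ne]
    _ = _ := setLIntegral_rnDeriv_mul hν ((hθm.div hνm).mul hf).aemeasurable hE

/-- Hölder's inequality for a change of measure from `ν` to `θ ≪ ν`. -/
lemma lintegral_le_rnDeriv_div_Lp_mul_Lq (θ ν : Measure S) [SigmaFinite θ] [SigmaFinite ν]
    (h : θ ≪ ν) {p q : ℝ} (hpq : p.HolderConjugate q) {f : S → ℝ≥0∞} (hf : Measurable f) :
    ∫⁻ x, f x ∂θ ≤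
      (∫⁻ x in {x | 0 < θ.rnDeriv (θ + ν) x ∧ 0 < ν.rnDeriv (θ + ν) x},
        (θ.rnDeriv (θ + ν) x / ν.rnDeriv (θ + ν) x) ^ p ∂ν) ^ (1 / p) *
      (∫⁻ x, f x ^ q ∂ν) ^ (1 / q) := by
  rw [lintegral_eq_setLIntegral_mul_rnDeriv_div θ ν h hf]
  have hd : Measurable fun x => θ.rnDeriv (θ + ν) x / ν.rnDeriv (θ + ν) x :=
    (Measure.measurable_rnDeriv θ (θ + ν)).div (Measure.measurable_rnDeriv ν (θ + ν))
  refine (ENNReal.lintegral_mul_le_Lp_mul_Lq _ hpq hd.aemeasurable hf.aemeasurable).trans ?_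
  have hq : 0 ≤ 1 / q := one_div_nonneg.2 hpq.symm.nonneg
  gcongr
  exact Measure.restrict_le_self

end

/-- **Upper bound on risk-sensitive functionals (Corollary, right inequality).**
For probability measures `θ, ν`, `α > 1`, and any measurable `g` (not necessarily bounded),
`(1/(α-1)) log ∫ e^{(α-1)g} dθ ≤ (1/α) log ∫ e^{αg} dν + R_α(θ‖ν)`,
with integrals taken in `[0,∞]` and the inequality interpreted in `[-∞,∞]`. -/
theorem renyi_upper_bound {S : Type*} [MeasurableSpace S]
    (θ ν : Measure S) [IsProbabilityMeasure θ] [IsProbabilityMeasure ν]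
    (α : ℝ) (hα : 1 < α) (g : S → ℝ) (hg : Measurable g) :
    (((α - 1)⁻¹ : ℝ) : EReal)
        * ENNReal.log (∫⁻ x, ENNReal.ofReal (Real.exp ((α - 1) * g x)) ∂θ)
      ≤ ((α⁻¹ : ℝ) : EReal)
          * ENNReal.log (∫⁻ x, ENNReal.ofReal (Real.exp (α * g x)) ∂ν)
        + renyiDiv α θ ν := by
  have hα0 : 0 < α := zero_lt_one.trans hα
  have hα1 : 0 < α - 1 := sub_pos.2 hα
  rw [renyiDiv, if_neg hα0.not_gt, renyiDivAux]
  split_ifs with hac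
  · rw [← ENNReal.log_rpow, ← ENNReal.log_rpow, EReal.add_top_of_ne_bot]
    · exact le_top
    have hpos : ∫⁻ x, ENNReal.ofReal (Real.exp (α * g x)) ∂ν ≠ 0 := by
      rw [Ne, lintegral_eq_zero_iff (by fun_prop)]
      intro h0
      obtain ⟨x, hx⟩ := h0.exists
      exact (ENNReal.ofReal_pos.2 (Real.exp_pos _)).ne' hx
    rw [Ne, ENNReal.log_eq_bot_iff, ENNReal.rpow_eq_zero_iff]
    rintro (⟨h0, -⟩ | ⟨-, hneg⟩)
    · exact hpos h0
    · exact (inv_pos.2 hα0).not_gt hneg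
  · have hθν : θ ≪ ν := not_not.1 fun h => hac ⟨hα, h⟩
    have holder := lintegral_le_rnDeriv_div_Lp_mul_Lq θ ν hθν
      (Real.HolderConjugate.conjExponent hα)
      (f := fun x => ENNReal.ofReal (Real.exp ((α - 1) * g x))) (by fun_prop)
    have hexp : ∀ x, ENNReal.ofReal (Real.exp ((α - 1) * g x)) ^ α.conjExponent =
        ENNReal.ofReal (Real.exp (α * g x)) := fun x => by
      rw [ENNReal.ofReal_rpow_of_pos (Real.exp_pos _), ← Real.exp_mul, Real.conjExponent]
      congr 2
      field_simp
    simp only [hexp] at holder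
    rw [← ENNReal.log_rpow, ← ENNReal.log_rpow, ← ENNReal.log_rpow, ← ENNReal.log_mul_add]
    refine ENNReal.log_le_log
      ((ENNReal.rpow_le_rpow holder (inv_nonneg.2 hα1.le)).trans_eq ?_)
    rw [ENNReal.mul_rpow_of_nonneg _ _ (inv_nonneg.2 hα1.le), ← ENNReal.rpow_mul,
      ← ENNReal.rpow_mul, mul_comm]
    congr 2
    · rw [Real.conjExponent]
      field_simp
    · field_simp
end

section
/- Let S be a measurable space, let θ and ν be probability measures on S, let α > 2, and let A be a measurable subset of S. Then (1/(α−2)) log ν(A) − R_{α−1}(ν‖θ) ≤ (1/(α−1)) log θ(A), with the convention log 0 = −∞, the expression ∞ − ∞ on the left-hand side interpreted as −∞, and the inequality interpreted in [−∞, +∞]. -/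
open MeasureTheory Real ProbabilityTheory
open scoped Classical

/-- If `ν ≪ θ`, then `ν A` is the `θ`-integral of the density ratio over the part of `A` where both
densities are positive. -/
lemma setLIntegral_rnDeriv_add_div {S : Type*} [MeasurableSpace S] (ν θ : Measure S)
    [IsFiniteMeasure ν] [IsFiniteMeasure θ] (hνθ : ν ≪ θ) (A : Set S) (hA : MeasurableSet A) :
    ∫⁻ x in A ∩ {x | 0 < ν.rnDeriv (ν + θ) x ∧ 0 < θ.rnDeriv (ν + θ) x},
      ν.rnDeriv (ν + θ) x / θ.rnDeriv (ν + θ) x ∂θ = ν A := by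
  have hν : ν ≪ ν + θ := Measure.AbsolutelyContinuous.rfl.add_right θ
  have hθ : θ ≪ ν + θ := add_comm θ ν ▸ Measure.AbsolutelyContinuous.rfl.add_right ν
  have hν_meas := Measure.measurable_rnDeriv ν (ν + θ)
  have hθ_meas := Measure.measurable_rnDeriv θ (ν + θ)
  set D : Set S := {x | 0 < ν.rnDeriv (ν + θ) x ∧ 0 < θ.rnDeriv (ν + θ) x}
  have hD : MeasurableSet D :=
    (measurableSet_lt measurable_const hν_meas).inter (measurableSet_lt measurable_const hθ_meas)
  have hD_ae : ∀ᵐ x ∂ν, x ∈ D := by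
    filter_upwards [Measure.rnDeriv_pos hν, hνθ.ae_le (Measure.rnDeriv_pos hθ)] with x h1 h2
    exact ⟨h1, h2⟩
  rw [← Measure.measure_inter_eq_of_ae hD_ae, Set.inter_comm D A, ← Measure.setLIntegral_rnDeriv hν]
  refine (setLIntegral_rnDeriv_mul hθ (hν_meas.div hθ_meas).aemeasurable
    (hA.inter hD)).symm.trans ?_
  refine setLIntegral_congr_fun_ae (hA.inter hD) ?_
  filter_upwards [Measure.rnDeriv_lt_top θ (ν + θ)] with x hx hxD
  exact ENNReal.mul_div_cancel hxD.2.2.ne' hx.ne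

/-- Hölder's inequality on a set, against the constant function `1`. -/
lemma setLIntegral_le_rpow_mul_measure_rpow {S : Type*} [MeasurableSpace S] (θ : Measure S)
    {p : ℝ} (hp : 1 < p) {f : S → ENNReal} (hf : Measurable f) (B : Set S) :
    ∫⁻ x in B, f x ∂θ ≤ (∫⁻ x in B, f x ^ p ∂θ) ^ p⁻¹ * θ B ^ ((p - 1) / p) := by
  have hpq := Real.HolderConjugate.conjExponent hp
  simpa [Real.conjExponent] using ENNReal.lintegral_mul_le_Lp_mul_Lq (θ.restrict B) hpq
    hf.aemeasurable (g := 1) measurable_one.aemeasurable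

/-- **Lower bound on probabilities of events.** For probability measures `θ, ν`, `α > 2`, and a
measurable set `A`, `(1/(α-2)) log ν(A) - R_{α-1}(ν‖θ) ≤ (1/(α-1)) log θ(A)`, with the
conventions `log 0 = -∞` and `∞ - ∞ = -∞` (as in `EReal` subtraction), the inequality being
interpreted in `[-∞,∞]`. -/
theorem renyi_event_lower_bound {S : Type*} [MeasurableSpace S]
    (θ ν : Measure S) [IsProbabilityMeasure θ] [IsProbabilityMeasure ν]
    (α : ℝ) (hα : 2 < α) (A : Set S) (hA : MeasurableSet A) :
    (((α - 2)⁻¹ : ℝ) : EReal) * ENNReal.log (ν A) - renyiDiv (α - 1) ν θ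
      ≤ (((α - 1)⁻¹ : ℝ) : EReal) * ENNReal.log (θ A) := by
  have h₁ : 0 < α - 1 := by linarith
  have h₂ : 0 < α - 2 := by linarith
  rw [renyiDiv, if_neg h₁.not_gt, renyiDivAux]
  split_ifs with h
  · simp
  have hνθ : ν ≪ θ := by
    by_contra hc
    exact h ⟨by linarith, hc⟩
  apply EReal.sub_le_of_le_add'
  set D : Set S := {x | 0 < ν.rnDeriv (ν + θ) x ∧ 0 < θ.rnDeriv (ν + θ) x}
  set I := ∫⁻ x in D, (ν.rnDeriv (ν + θ) x / θ.rnDeriv (ν + θ) x) ^ (α - 1) ∂θ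
  have key : ν A ≤ I ^ (α - 1)⁻¹ * θ A ^ ((α - 2) / (α - 1)) := by
    rw [← setLIntegral_rnDeriv_add_div ν θ hνθ A hA]
    refine (setLIntegral_le_rpow_mul_measure_rpow θ (p := α - 1) (by linarith)
      ((Measure.measurable_rnDeriv _ _).div (Measure.measurable_rnDeriv _ _)) _).trans ?_
    rw [show α - 1 - 1 = α - 2 by ring]
    gcongr
    · exact lintegral_mono_set Set.inter_subset_right
    · exact Set.inter_subset_left
  have hlog := ENNReal.log_le_log key
  rw [ENNReal.log_mul_add, ENNReal.log_rpow, ENNReal.log_rpow] at hlog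
  have hc : (0 : EReal) ≤ (((α - 2)⁻¹ : ℝ) : EReal) := by exact_mod_cast (inv_pos.2 h₂).le
  refine (mul_le_mul_of_nonneg_left hlog hc).trans_eq ?_
  rw [EReal.left_distrib_of_nonneg_of_ne_top hc (EReal.coe_ne_top _), ← mul_assoc, ← mul_assoc,
    ← EReal.coe_mul, ← EReal.coe_mul]
  congr 4
  · rw [show α - 1 - 1 = α - 2 by ring, mul_inv, mul_comm]
  · field_simp
end

section
/- Let S be a measurable space, let θ and ν be probability measures on S, let α > 2, and let A be a measurable subset of S. If R_α(θ‖ν) ≤ d₁ and R_{α−1}(ν‖θ) ≤ d₂ for finite constants d₁, d₂ ≥ 0, then ν(A)^{(α−1)/(α−2)} e^{−(α−1) d₂} ≤ θ(A) ≤ ν(A)^{(α−1)/α} e^{(α−1) d₁}. -/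
open MeasureTheory Real ProbabilityTheory
open scoped Classical

open scoped ENNReal

/-- Hölder's inequality for events: `ν(A) ≤ ‖dν/dθ‖_{L^β(θ)} θ(A)^{(β-1)/β}` when `ν ≪ θ`. -/
theorem measure_le_lintegral_rnDeriv_div_rpow_mul {S : Type*} [MeasurableSpace S]
    (ν θ : Measure S) [IsFiniteMeasure ν] [IsFiniteMeasure θ] (hac : ν ≪ θ)
    {β : ℝ} (hβ : 1 < β) {A : Set S} (hA : MeasurableSet A) :
    ν A ≤ (∫⁻ x in {x | 0 < ν.rnDeriv (ν + θ) x ∧ 0 < θ.rnDeriv (ν + θ) x},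
      (ν.rnDeriv (ν + θ) x / θ.rnDeriv (ν + θ) x) ^ β ∂θ) ^ (1 / β) * θ A ^ ((β - 1) / β) := by
  set μ := ν + θ
  set p := ν.rnDeriv μ
  set q := θ.rnDeriv μ
  set E := {x | 0 < p x ∧ 0 < q x}
  have hνμ : ν ≪ μ := Measure.AbsolutelyContinuous.rfl.add_right θ
  have hθμ : θ ≪ μ := Measure.absolutelyContinuous_of_le (Measure.le_add_left le_rfl)
  have hp : Measurable p := Measure.measurable_rnDeriv _ _
  have hq : Measurable q := Measure.measurable_rnDeriv _ _
  have hEm : MeasurableSet E :=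
    (measurableSet_lt measurable_const hp).inter (measurableSet_lt measurable_const hq)
  have hνE : ∀ᵐ x ∂ν, x ∈ E := by
    filter_upwards [Measure.rnDeriv_pos hνμ, hac.ae_le (Measure.rnDeriv_pos hθμ)] with x h₁ h₂
    exact ⟨h₁, h₂⟩
  have hνA : ν A = ∫⁻ x in A ∩ E, p x / q x ∂θ := by
    have hAE : ν A = ν (A ∩ E) := measure_congr <| by
      filter_upwards [hνE] with x hx
      exact propext ⟨fun h ↦ ⟨h, hx⟩, fun h ↦ h.1⟩
    rw [hAE, ← Measure.setLIntegral_rnDeriv hνμ (A ∩ E),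
      ← setLIntegral_rnDeriv_mul (f := fun x ↦ p x / q x) hθμ (hp.div hq).aemeasurable (hA.inter hEm)]
    refine setLIntegral_congr_fun_ae (hA.inter hEm) ?_
    filter_upwards [Measure.rnDeriv_lt_top θ μ] with x hx hxE
    exact (ENNReal.mul_div_cancel hxE.2.2.ne' hx.ne).symm
  have hconj : β.HolderConjugate (β / (β - 1)) := Real.HolderConjugate.conjExponent hβ
  have hHolder := ENNReal.lintegral_mul_le_Lp_mul_Lq (θ.restrict (A ∩ E)) hconj
    (hp.div hq).aemeasurable (measurable_const (a := (1 : ℝ≥0∞))).aemeasurable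
  simp only [Pi.mul_apply, Pi.div_apply, mul_one, ENNReal.one_rpow, lintegral_const, one_mul,
    Measure.restrict_apply_univ, one_div_div] at hHolder
  rw [hνA]
  refine hHolder.trans ?_
  gcongr
  · exact Set.inter_subset_right
  · exact Set.inter_subset_left

theorem measure_le_rpow_mul_exp_of_renyiDivAux_le {S : Type*} [MeasurableSpace S]
    (ν θ : Measure S) [IsFiniteMeasure ν] [IsFiniteMeasure θ]
    {β d : ℝ} (hβ : 1 < β) (hR : renyiDivAux β ν θ ≤ (d : EReal))
    {A : Set S} (hA : MeasurableSet A) :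
    ν A ≤ θ A ^ ((β - 1) / β) * ENNReal.ofReal (Real.exp ((β - 1) * d)) := by
  have hac : ν ≪ θ := by
    by_contra h
    simp [renyiDivAux, hβ, h] at hR
  have hHolder := measure_le_lintegral_rnDeriv_div_rpow_mul ν θ hac hβ hA
  rw [renyiDivAux, if_neg (by tauto), ← ENNReal.log_rpow, ← EReal.log_exp (d : EReal),
    ENNReal.log_le_log_iff, EReal.exp_coe] at hR
  refine hHolder.trans ?_
  rw [mul_comm]
  gcongr
  have hβ₀ : β ≠ 0 := by linarith
  have hβ₁ : β - 1 ≠ 0 := by linarith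
  have hpow := ENNReal.rpow_le_rpow hR (show 0 ≤ β - 1 by linarith)
  rwa [← ENNReal.rpow_mul, ENNReal.ofReal_rpow_of_pos (Real.exp_pos d), ← Real.exp_mul,
    show (β * (β - 1))⁻¹ * (β - 1) = 1 / β by field_simp, mul_comm d] at hpow

/-- **Two-sided robust bounds on event probabilities.** For probability measures `θ, ν`, `α > 2`,
a measurable set `A`, and finite constants `d₁, d₂ ≥ 0` with `R_α(θ‖ν) ≤ d₁` and
`R_{α-1}(ν‖θ) ≤ d₂`, one has
`ν(A)^{(α-1)/(α-2)} e^{-(α-1)d₂} ≤ θ(A) ≤ ν(A)^{(α-1)/α} e^{(α-1)d₁}`. -/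
theorem renyi_event_two_sided_bound {S : Type*} [MeasurableSpace S]
    (θ ν : Measure S) [IsProbabilityMeasure θ] [IsProbabilityMeasure ν]
    (α : ℝ) (hα : 2 < α) (A : Set S) (hA : MeasurableSet A)
    (d₁ d₂ : ℝ) (hd₁ : 0 ≤ d₁) (hd₂ : 0 ≤ d₂)
    (hR₁ : renyiDiv α θ ν ≤ (d₁ : EReal)) (hR₂ : renyiDiv (α - 1) ν θ ≤ (d₂ : EReal)) :
    ν A ^ ((α - 1) / (α - 2)) * ENNReal.ofReal (Real.exp (-(α - 1) * d₂)) ≤ θ A ∧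
      θ A ≤ ν A ^ ((α - 1) / α) * ENNReal.ofReal (Real.exp ((α - 1) * d₁)) := by
  have h₁ : renyiDivAux α θ ν ≤ (d₁ : EReal) := by
    rwa [renyiDiv, if_neg (by linarith)] at hR₁
  have h₂ : renyiDivAux (α - 1) ν θ ≤ (d₂ : EReal) := by
    rwa [renyiDiv, if_neg (by linarith)] at hR₂
  refine ⟨?_, measure_le_rpow_mul_exp_of_renyiDivAux_le θ ν (by linarith) h₁ hA⟩
  have hν := measure_le_rpow_mul_exp_of_renyiDivAux_le ν θ (by linarith) h₂ hA
  have hα₁ : α - 1 ≠ 0 := by linarith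
  have hα₂ : α - 2 ≠ 0 := by linarith
  have hexp : 0 ≤ (α - 1) / (α - 2) := div_nonneg (by linarith) (by linarith)
  have hpow := ENNReal.rpow_le_rpow hν hexp
  rw [ENNReal.mul_rpow_of_nonneg _ _ hexp, ← ENNReal.rpow_mul,
    ENNReal.ofReal_rpow_of_pos (Real.exp_pos _), ← Real.exp_mul,
    show (α - 1 - 1) / (α - 1) * ((α - 1) / (α - 2)) = 1 by field_simp; ring,
    show (α - 1 - 1) * d₂ * ((α - 1) / (α - 2)) = (α - 1) * d₂ by field_simp; ring,
    ENNReal.rpow_one] at hpow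
  calc ν A ^ ((α - 1) / (α - 2)) * ENNReal.ofReal (Real.exp (-(α - 1) * d₂))
      ≤ θ A * ENNReal.ofReal (Real.exp ((α - 1) * d₂)) *
          ENNReal.ofReal (Real.exp (-(α - 1) * d₂)) := by gcongr
    _ = θ A := by
      rw [mul_assoc, ← ENNReal.ofReal_mul (Real.exp_pos _).le, ← Real.exp_add, neg_mul, add_neg_cancel]
      simp
end

section
/- Let S be a measurable space, let ν be a probability measure on S, and let g : S → ℝ be bounded and measurable. Then ∫_S g dν = inf over all probability measures θ on S of [ log ∫_S e^{g} dθ + R(ν‖θ) ]. -/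
open MeasureTheory Real ProbabilityTheory
open scoped Classical

/-- Relative entropy (Kullback–Leibler divergence) `R(ν‖θ) = ∫ log(dν/dθ) dν` when `ν ≪ θ` and
the log-likelihood ratio is `ν`-integrable, and `+∞` otherwise (which is consistent, since the
integrand `(dν/dθ) log(dν/dθ)` is bounded below, so non-integrability can only produce `+∞`). -/
noncomputable def klDiv' {S : Type*} [MeasurableSpace S] (ν θ : Measure S) : EReal :=
  if ν ≪ θ ∧ Integrable (MeasureTheory.llr ν θ) ν
  then ((∫ x, MeasureTheory.llr ν θ x ∂ν : ℝ) : EReal)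
  else ⊤

/-- One inequality of the Gibbs variational principle: tilting the reference measure by `g` and
applying Gibbs' inequality bounds the mean of `g` by the log-moment plus the relative entropy. -/
lemma integral_le_log_integral_exp_add_integral_llr {S : Type*} [MeasurableSpace S]
    {ν θ : Measure S} [IsProbabilityMeasure ν] [IsProbabilityMeasure θ] {g : S → ℝ}
    (hνθ : ν ≪ θ) (h_int : Integrable (llr ν θ) ν) (hgν : Integrable g ν)
    (hgθ : Integrable (fun x ↦ exp (g x)) θ) :
    ∫ x, g x ∂ν ≤ log (∫ x, exp (g x) ∂θ) + ∫ x, llr ν θ x ∂ν := by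
  have : IsProbabilityMeasure (θ.tilted g) := isProbabilityMeasure_tilted hgθ
  have gibbs := InformationTheory.integral_llr_add_sub_measure_univ_nonneg
    (hνθ.trans (absolutelyContinuous_tilted hgθ))
    (integrable_llr_tilted_right hνθ hgν h_int hgθ)
  rw [integral_llr_tilted_right hνθ hgν hgθ h_int, probReal_univ, probReal_univ] at gibbs
  linarith

/-- The relative entropy of a probability measure with respect to its tilting by `f`. -/
lemma klDiv'_tilted_right {S : Type*} [MeasurableSpace S] {ν : Measure S}
    [IsProbabilityMeasure ν] {f : S → ℝ} (hf : Integrable f ν)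
    (hexp : Integrable (fun x ↦ exp (f x)) ν) :
    klDiv' ν (ν.tilted f) = ((log (∫ x, exp (f x) ∂ν) - ∫ x, f x ∂ν : ℝ) : EReal) := by
  have hac : ν ≪ ν := Measure.AbsolutelyContinuous.rfl
  have hself : Integrable (llr ν ν) ν := (integrable_zero S ℝ ν).congr (llr_self ν).symm
  have hzero : ∫ x, llr ν ν x ∂ν = 0 := by simp [integral_congr_ae (llr_self ν)]
  rw [klDiv', if_pos ⟨absolutelyContinuous_tilted hexp,
    integrable_llr_tilted_right hac hf hself hexp⟩,
    integral_llr_tilted_right hac hf hexp hself, hzero]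
  congr 1
  ring

/-- Tilting by `-g` inverts the exponential moment of `g`. -/
lemma integral_exp_tilted_neg {S : Type*} [MeasurableSpace S] (ν : Measure S)
    [IsProbabilityMeasure ν] (g : S → ℝ) :
    ∫ x, exp (g x) ∂(ν.tilted (-g)) = (∫ x, exp ((-g) x) ∂ν)⁻¹ := by
  rw [integral_exp_tilted]
  simp

/-- **Legendre-type infimum representation of the mean via relative entropy.**
For a probability measure `ν` and bounded measurable `g`,
`∫ g dν = inf_θ [ log ∫ e^{g} dθ + R(ν‖θ) ]`, the infimum being over all probability
measures `θ`. -/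
theorem mean_inf_representation {S : Type*} [MeasurableSpace S]
    (ν : Measure S) [IsProbabilityMeasure ν]
    (g : S → ℝ) (hg : Measurable g) (hgbd : ∃ C : ℝ, ∀ x, |g x| ≤ C) :
    ((∫ x, g x ∂ν : ℝ) : EReal) =
      ⨅ (θ : Measure S) (_ : IsProbabilityMeasure θ),
        ((Real.log (∫ x, Real.exp (g x) ∂θ) : ℝ) : EReal) + klDiv' ν θ := by
  obtain ⟨C, hC⟩ := hgbd
  have hint (μ : Measure S) [IsProbabilityMeasure μ] : Integrable g μ :=
    Integrable.of_bound hg.aestronglyMeasurable C (ae_of_all _ hC)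
  have hexp (f : S → ℝ) (hf : Measurable f) (hfC : ∀ x, |f x| ≤ C) (μ : Measure S)
      [IsProbabilityMeasure μ] : Integrable (fun x ↦ exp (f x)) μ :=
    Integrable.of_bound hf.exp.aestronglyMeasurable (exp C) (ae_of_all _ fun x ↦ by
      rw [norm_eq_abs, abs_exp]
      exact exp_le_exp.mpr ((le_abs_self _).trans (hfC x)))
  refine le_antisymm (le_iInf₂ fun θ hθ ↦ ?_) ?_
  · by_cases h : ν ≪ θ ∧ Integrable (llr ν θ) ν
    · rw [klDiv', if_pos h, ← EReal.coe_add, EReal.coe_le_coe_iff]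
      exact integral_le_log_integral_exp_add_integral_llr h.1 h.2 (hint ν) (hexp g hg hC θ)
    · rw [klDiv', if_neg h, EReal.coe_add_top]
      exact le_top
  · have hneg : Integrable (fun x ↦ exp ((-g) x)) ν :=
      hexp (-g) hg.neg (fun x ↦ by simpa using hC x) ν
    refine (iInf₂_le (ν.tilted (-g)) (isProbabilityMeasure_tilted hneg)).trans_eq ?_
    rw [klDiv'_tilted_right (hint ν).neg hneg, integral_exp_tilted_neg, ← EReal.coe_add, log_inv]
    simp [integral_neg]
end

section
/- Fix n ≥ 1 and α > 1. Let θ₁ and ν₁ be probability measures on ℝ, let θ = θ₁^{⊗n} and ν = ν₁^{⊗n} be the corresponding n-fold product measures on ℝⁿ, let X₁, …, X_n denote the coordinate maps, and let L_n = (1/n) Σ_{i=1}^{n} δ_{X_i} be the empirical measure, viewed as a random element of the space of Borel probability measures on ℝ with the weak topology. Then for every bounded Borel measurable function G on the space of Borel probability measures on ℝ, (1/(n(α−1))) log E_θ[e^{(α−1) n G(L_n)}] ≤ (1/(nα)) log E_ν[e^{α n G(L_n)}] + R_α(θ₁‖ν₁), where E_θ and E_ν denote expectation under θ and ν respectively.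 -/
open MeasureTheory Real ProbabilityTheory
open scoped Classical ENNReal NNReal

/-- **Tonelli's theorem** for a product of functions of the individual coordinates. -/
lemma lintegral_fintype_prod_eq_prod {ι : Type*} [Fintype ι] {E : ι → Type*}
    {mE : ∀ i, MeasurableSpace (E i)} (μ : ∀ i, Measure (E i)) [∀ i, IsProbabilityMeasure (μ i)]
    (f : ∀ i, E i → ℝ≥0∞) (hf : ∀ i, Measurable (f i)) :
    ∫⁻ x, ∏ i, f i (x i) ∂Measure.pi μ = ∏ i, ∫⁻ x, f i x ∂μ i := by
  have h := lintegral_prod_eq_prod_lintegral_of_indepFun Finset.univ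
    (fun i (x : ∀ i, E i) => f i (x i))
    (iIndepFun_pi (μ := μ) (X := f) fun i => (hf i).aemeasurable)
    fun i => (hf i).comp (measurable_pi_apply i)
  rw [h]
  refine Finset.prod_congr rfl fun i _ => ?_
  exact (measurePreserving_eval μ i).lintegral_comp (hf i)

/-- A finite product of probability measures with densities has the product density. -/
lemma pi_withDensity_eq_withDensity_prod {ι : Type*} [Fintype ι] {E : ι → Type*}
    {mE : ∀ i, MeasurableSpace (E i)} (μ : ∀ i, Measure (E i)) [∀ i, IsProbabilityMeasure (μ i)]
    (f : ∀ i, E i → ℝ≥0∞) (hf : ∀ i, Measurable (f i))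
    [∀ i, SigmaFinite ((μ i).withDensity (f i))] :
    Measure.pi (fun i => (μ i).withDensity (f i))
      = (Measure.pi μ).withDensity fun x => ∏ i, f i (x i) := by
  refine Measure.pi_eq fun s hs => ?_
  have hind : (Set.univ.pi s).indicator (fun x : ∀ i, E i => ∏ i, f i (x i))
      = fun x => ∏ i, (s i).indicator (f i) (x i) := by
    ext x
    by_cases hx : x ∈ Set.univ.pi s
    · rw [Set.indicator_of_mem hx]
      exact Finset.prod_congr rfl fun i _ =>
        (Set.indicator_of_mem (hx i (Set.mem_univ i)) _).symm
    · rw [Set.indicator_of_notMem hx]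
      obtain ⟨i, hi⟩ : ∃ i, x i ∉ s i := by simpa [Set.mem_pi] using hx
      exact (Finset.prod_eq_zero (Finset.mem_univ i) (Set.indicator_of_notMem hi _)).symm
  have hms : MeasurableSet (Set.univ.pi s) := MeasurableSet.univ_pi hs
  rw [withDensity_apply _ hms, ← lintegral_indicator hms, hind,
    lintegral_fintype_prod_eq_prod μ _ fun i => (hf i).indicator (hs i)]
  refine Finset.prod_congr rfl fun i _ => ?_
  rw [withDensity_apply _ (hs i), lintegral_indicator (hs i)]

/-- The power integral defining the Rényi divergence, in terms of the Radon–Nikodym derivative. -/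
lemma setLIntegral_rnDeriv_div_rnDeriv_rpow {S : Type*} [MeasurableSpace S] {α : ℝ} (hα : 0 < α)
    (ν θ : Measure S) [SigmaFinite ν] [SigmaFinite θ] :
    ∫⁻ x in {x | 0 < ν.rnDeriv (ν + θ) x ∧ 0 < θ.rnDeriv (ν + θ) x},
      (ν.rnDeriv (ν + θ) x / θ.rnDeriv (ν + θ) x) ^ α ∂θ = ∫⁻ x, ν.rnDeriv θ x ^ α ∂θ := by
  have hset : MeasurableSet {x | 0 < ν.rnDeriv (ν + θ) x ∧ 0 < θ.rnDeriv (ν + θ) x} :=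
    (measurableSet_lt measurable_const (Measure.measurable_rnDeriv _ _)).inter
      (measurableSet_lt measurable_const (Measure.measurable_rnDeriv _ _))
  have hac : θ ≪ ν + θ := Measure.AbsolutelyContinuous.rfl.add_right' ν
  rw [← lintegral_indicator hset]
  refine lintegral_congr_ae ?_
  filter_upwards [Measure.rnDeriv_eq_div_rnDeriv_add ν θ, Measure.rnDeriv_pos hac]
    with x hx hpos
  rw [hx]
  by_cases h : 0 < ν.rnDeriv (ν + θ) x
  · rw [Set.indicator_of_mem (by exact ⟨h, hpos⟩)]
  · rw [Set.indicator_of_notMem fun h' => h h'.1, not_lt.mp h |>.antisymm zero_le,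
      ENNReal.zero_div, ENNReal.zero_rpow_of_pos hα]

/-- Hölder's inequality after the change of measure from `θ₁^⊗n` to `ν₁^⊗n`. -/
lemma lintegral_pi_rpow_le {n : ℕ} {α : ℝ} (hα : 1 < α) {S : Type*} [MeasurableSpace S]
    {θ₁ ν₁ : Measure S} [IsProbabilityMeasure θ₁] [IsProbabilityMeasure ν₁] (hac : θ₁ ≪ ν₁)
    {φ : (Fin n → S) → ℝ≥0∞} (hφ : Measurable φ) :
    ∫⁻ ω, φ ω ^ (α - 1) ∂(Measure.pi fun _ : Fin n => θ₁)
      ≤ ((∫⁻ x, θ₁.rnDeriv ν₁ x ^ α ∂ν₁) ^ n) ^ (1 / α)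
        * (∫⁻ ω, φ ω ^ α ∂(Measure.pi fun _ : Fin n => ν₁)) ^ (1 / (α / (α - 1))) := by
  have hf := Measure.measurable_rnDeriv θ₁ ν₁
  have hθ : ν₁.withDensity (θ₁.rnDeriv ν₁) = θ₁ := Measure.withDensity_rnDeriv_eq _ _ hac
  have hd : Measurable fun ω : Fin n → S => ∏ i, θ₁.rnDeriv ν₁ (ω i) := by fun_prop
  have hpi : Measure.pi (fun _ : Fin n => θ₁)
      = (Measure.pi fun _ : Fin n => ν₁).withDensity fun ω => ∏ i, θ₁.rnDeriv ν₁ (ω i) := by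
    rw [← pi_withDensity_eq_withDensity_prod (fun _ : Fin n => ν₁) _ fun _ => hf]
    simp_rw [hθ]
  have hα0 : (0 : ℝ) < α := by linarith
  have hα1 : α - 1 ≠ 0 := by linarith
  have hconj : α.HolderConjugate (α / (α - 1)) := Real.HolderConjugate.conjExponent hα
  rw [hpi, lintegral_withDensity_eq_lintegral_mul _ hd (hφ.pow_const _)]
  refine (ENNReal.lintegral_mul_le_Lp_mul_Lq _ hconj hd.aemeasurable
    (hφ.pow_const _).aemeasurable).trans_eq ?_
  congr 2
  · simp_rw [← ENNReal.prod_rpow_of_nonneg hα0.le]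
    rw [lintegral_fintype_prod_eq_prod (fun _ : Fin n => ν₁) _ fun _ => hf.pow_const α]
    simp
  · refine lintegral_congr fun ω => ?_
    rw [← ENNReal.rpow_mul, mul_div_cancel₀ _ hα1]

/-- The empirical measure is a measurable function of the sample. -/
lemma measurable_empiricalMeasure {S : Type*} [MeasurableSpace S] (n : ℕ) :
    Measurable fun ω : Fin n → S => (n : ℝ≥0∞)⁻¹ • ∑ i : Fin n, Measure.dirac (ω i) := by
  refine Measure.measurable_of_measurable_coe _ fun s hs => ?_
  simp only [Measure.smul_apply, Measure.coe_finsetSum, Finset.sum_apply, smul_eq_mul]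
  have h (i : Fin n) : Measurable fun ω : Fin n → S => Measure.dirac (ω i) s :=
    (Measure.measurable_coe hs).comp (Measure.measurable_dirac.comp (measurable_pi_apply i))
  fun_prop

/-- An exponential of a bounded measurable function is integrable for a finite measure. -/
lemma integrable_exp_const_mul_of_abs_le {Ω : Type*} [MeasurableSpace Ω] (μ : Measure Ω)
    [IsFiniteMeasure μ] {F : Ω → ℝ} (hF : Measurable F) {C : ℝ} (hC : ∀ ω, |F ω| ≤ C) (c : ℝ) :
    Integrable (fun ω => Real.exp (c * F ω)) μ := by
  refine Integrable.of_bound (by fun_prop) (Real.exp (|c| * C)) (.of_forall fun ω => ?_)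
  rw [Real.norm_eq_abs, Real.abs_exp, Real.exp_le_exp]
  refine (le_abs_self _).trans ?_
  rw [abs_mul]
  exact mul_le_mul_of_nonneg_left (hC ω) (abs_nonneg c)

/-- **Robust bound for risk-sensitive functionals of the empirical measure.** Let `θ = θ₁^⊗n`
and `ν = ν₁^⊗n` be `n`-fold products of probability measures on `ℝ`, let
`Lₙ(ω) = n⁻¹ ∑ᵢ δ_{ωᵢ}` be the empirical measure of the coordinates, and let `G` be a bounded
measurable function on the space of (Borel) measures on `ℝ`. Then for `α > 1`,
`(1/(n(α-1))) log E_θ[e^{(α-1)nG(Lₙ)}] ≤ (1/(nα)) log E_ν[e^{αnG(Lₙ)}] + R_α(θ₁‖ν₁)`. -/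
theorem renyi_empirical_measure_bound (n : ℕ) (hn : 1 ≤ n) (α : ℝ) (hα : 1 < α)
    (θ₁ ν₁ : Measure ℝ) [IsProbabilityMeasure θ₁] [IsProbabilityMeasure ν₁]
    (G : Measure ℝ → ℝ) (hG : Measurable G) (hGbd : ∃ C : ℝ, ∀ μ, |G μ| ≤ C)
    (L : (Fin n → ℝ) → Measure ℝ)
    (hL : L = fun ω => (n : ℝ≥0∞)⁻¹ • ∑ i : Fin n, Measure.dirac (ω i)) :
    ((((n : ℝ) * (α - 1))⁻¹ *
        Real.log (∫ ω, Real.exp ((α - 1) * n * G (L ω)) ∂(Measure.pi fun _ : Fin n => θ₁))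
          : ℝ) : EReal)
      ≤ ((((n : ℝ) * α)⁻¹ *
          Real.log (∫ ω, Real.exp (α * n * G (L ω)) ∂(Measure.pi fun _ : Fin n => ν₁))
            : ℝ) : EReal)
        + renyiDiv α θ₁ ν₁ := by
  obtain ⟨C, hC⟩ := hGbd
  have hα0 : (0 : ℝ) < α := by linarith
  have hα1 : (0 : ℝ) < α - 1 := by linarith
  have hn0 : (0 : ℝ) < n := by exact_mod_cast hn
  rw [renyiDiv, if_neg hα0.not_gt, renyiDivAux]
  split_ifs with hac
  · rw [EReal.coe_add_top]
    exact le_top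
  replace hac : θ₁ ≪ ν₁ := by simpa [hα] using hac
  rw [setLIntegral_rnDeriv_div_rnDeriv_rpow hα0]
  have hF : Measurable fun ω => G (L ω) :=
    hG.comp (hL ▸ measurable_empiricalMeasure n)
  have hholder := lintegral_pi_rpow_le hα hac
    (φ := fun ω => ENNReal.ofReal (Real.exp (n * G (L ω))))
    (hF.const_mul _).exp.ennreal_ofReal
  have hexp (c : ℝ) (ω : Fin n → ℝ) :
      ENNReal.ofReal (Real.exp (n * G (L ω))) ^ c
        = ENNReal.ofReal (Real.exp (c * n * G (L ω))) := by
    rw [ENNReal.ofReal_rpow_of_pos (Real.exp_pos _), ← Real.exp_mul]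
    ring_nf
  have hint (μ : Measure (Fin n → ℝ)) [IsProbabilityMeasure μ] (c : ℝ) :
      Integrable (fun ω => Real.exp (c * n * G (L ω))) μ :=
    integrable_exp_const_mul_of_abs_le μ hF (fun ω => hC (L ω)) (c * n)
  have hlint (μ : Measure (Fin n → ℝ)) [IsProbabilityMeasure μ] (c : ℝ) :
      ∫⁻ ω, ENNReal.ofReal (Real.exp (c * n * G (L ω))) ∂μ
        = ENNReal.ofReal (∫ ω, Real.exp (c * n * G (L ω)) ∂μ) :=
    (ofReal_integral_eq_lintegral_ofReal (hint μ c) (.of_forall fun _ => (Real.exp_pos _).le)).symm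
  simp_rw [hexp, hlint] at hholder
  have hA := integral_exp_pos (hint (Measure.pi fun _ : Fin n => θ₁) (α - 1))
  have hB := integral_exp_pos (hint (Measure.pi fun _ : Fin n => ν₁) α)
  set A := ∫ ω, Real.exp ((α - 1) * n * G (L ω)) ∂(Measure.pi fun _ : Fin n => θ₁)
  set B := ∫ ω, Real.exp (α * n * G (L ω)) ∂(Measure.pi fun _ : Fin n => ν₁)
  set I := ∫⁻ x, θ₁.rnDeriv ν₁ x ^ α ∂ν₁
  have hlog : (Real.log A : EReal)
      ≤ ((1 / α : ℝ) : EReal) * (n * ENNReal.log I)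
        + ((1 / (α / (α - 1)) : ℝ) : EReal) * Real.log B := by
    rw [← ENNReal.log_ofReal_of_pos hA, ← ENNReal.log_ofReal_of_pos hB, ← ENNReal.log_pow,
      ← ENNReal.log_rpow, ← ENNReal.log_rpow, ← ENNReal.log_mul_add]
    exact ENNReal.log_le_log hholder
  have hI0 : ENNReal.log I ≠ ⊥ := by
    intro h
    rw [h, EReal.mul_bot_of_pos (by exact_mod_cast hn0),
      EReal.coe_mul_bot_of_pos (by positivity), EReal.bot_add, le_bot_iff] at hlog
    exact EReal.coe_ne_bot _ hlog
  by_cases hItop : ENNReal.log I = ⊤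
  · rw [hItop, EReal.coe_mul_top_of_pos (by positivity), EReal.coe_add_top]
    exact le_top
  lift ENNReal.log I to ℝ using ⟨hItop, hI0⟩ with r
  have hlog' : Real.log A ≤ 1 / α * (n * r) + 1 / (α / (α - 1)) * Real.log B := by
    exact_mod_cast hlog
  norm_cast
  calc ((n : ℝ) * (α - 1))⁻¹ * Real.log A
      ≤ ((n : ℝ) * (α - 1))⁻¹ * (1 / α * (n * r) + 1 / (α / (α - 1)) * Real.log B) := by gcongr
    _ = ((n : ℝ) * α)⁻¹ * Real.log B + (α * (α - 1))⁻¹ * r := by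
      field_simp
      ring
end
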